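/- arXiv:2010.01511 — 10 statements merged into one kernel-verified Lean document; each statement's English description precedes it below -/
import Mathlib

section
/- Let m ≥ 1 be an integer and let q be a Pisot number with m < q < m+1. Then every non-real complex Galois conjugate q' of q satisfies |q'| ≥ 1/(m + 1/2), i.e. q has no non-real Galois conjugate of absolute value less than 2/(2m+1). -/
/-- A Pisot number: a real algebraic integer `q > 1` all of whose Galois conjugates
(the complex roots of its minimal polynomial over `ℚ` other than `q` itself)
have absolute value less than `1`. -/
def IsPisot (q : ℝ) : Prop :=
  1 < q ∧ IsIntegral ℤ q ∧
    ∀ z : ℂ, Polynomial.aeval z (minpoly ℚ q) = 0 → z ≠ (q : ℂ) → ‖z‖ < 1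

/-- `z` is a Galois conjugate of `q`: a complex root of the minimal polynomial of `q`
over `ℚ` other than `q` itself. -/
def IsPisotConj (q : ℝ) (z : ℂ) : Prop :=
  Polynomial.aeval z (minpoly ℚ q) = 0 ∧ z ≠ (q : ℂ)

open Polynomial in
/-- The product of the absolute values of the complex roots of the minimal polynomial of a nonzero
algebraic integer is at least `1`. -/
theorem one_le_prod_norm_roots_minpoly {q : ℝ} (hint : IsIntegral ℤ q) (h0 : q ≠ 0) :
    1 ≤ ∏ w ∈ ((minpoly ℚ q).aroots ℂ).toFinset, ‖w‖ := by
  have hQ : IsIntegral ℚ q := hint.tower_top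
  have hnodup : ((minpoly ℚ q).aroots ℂ).Nodup :=
    nodup_aroots_iff_of_splits (minpoly.ne_zero hQ) (IsAlgClosed.splits _) |>.2
      (minpoly.irreducible hQ).separable
  have hprod : ((minpoly ℚ q).map (algebraMap ℚ ℂ)).coeff 0 =
      (-1) ^ ((minpoly ℚ q).map (algebraMap ℚ ℂ)).natDegree * ((minpoly ℚ q).aroots ℂ).prod :=
    (IsAlgClosed.splits _).coeff_zero_eq_prod_roots_of_monic ((minpoly.monic hQ).map _)
  have hcoeff : (minpoly ℚ q).coeff 0 = ((minpoly ℤ q).coeff 0 : ℚ) := by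
    rw [minpoly.isIntegrallyClosed_eq_field_fractions' ℚ hint, coeff_map]
    rfl
  have hne : (minpoly ℤ q).coeff 0 ≠ 0 := by
    intro h
    apply minpoly.coeff_zero_ne_zero hQ h0
    rw [hcoeff, h, Int.cast_zero]
  have hnorm : ‖((minpoly ℚ q).aroots ℂ).prod‖ = |((minpoly ℤ q).coeff 0 : ℝ)| := by
    have h := congrArg norm hprod
    rw [coeff_map, hcoeff] at h
    simpa using h.symm
  have hfin : ∏ w ∈ ((minpoly ℚ q).aroots ℂ).toFinset, ‖w‖ =
      ‖((minpoly ℚ q).aroots ℂ).prod‖ := by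
    rw [← norm_prod, Finset.prod, Multiset.toFinset_val, hnodup.dedup, Multiset.map_id']
  rw [hfin, hnorm]
  exact_mod_cast Int.one_le_abs hne

/-- A non-real conjugate `z` of a Pisot number `q` satisfies `1 ≤ q * ‖z‖ ^ 2`, since `q`, `z` and
the complex conjugate of `z` are distinct and all other conjugates lie in the unit disc. -/
theorem IsPisot.one_le_mul_norm_sq {q : ℝ} (hq : IsPisot q) {z : ℂ} (hz : IsPisotConj q z)
    (him : z.im ≠ 0) : 1 ≤ q * ‖z‖ ^ 2 := by
  obtain ⟨hq1, hint, hconj⟩ := hq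
  obtain ⟨hroot, -⟩ := hz
  have hP : minpoly ℚ q ≠ 0 := minpoly.ne_zero hint.tower_top
  have hqz : (q : ℂ) ≠ z := fun h => him (by simp [← h])
  have hqc : (q : ℂ) ≠ starRingEnd ℂ z := fun h => him (by simpa using (congrArg Complex.im h).symm)
  have hzc : z ≠ starRingEnd ℂ z := fun h => him (Complex.conj_eq_iff_im.1 h.symm)
  have hrootq : Polynomial.aeval (q : ℂ) (minpoly ℚ q) = 0 := by
    have h := Polynomial.aeval_algebraMap_apply ℂ q (minpoly ℚ q)
    rwa [minpoly.aeval, map_zero] at h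
  have hrootc : Polynomial.aeval (starRingEnd ℂ z) (minpoly ℚ q) = 0 := by
    have h := Polynomial.aeval_algHom_apply (Complex.conjAe.toAlgHom.restrictScalars ℚ) z
      (minpoly ℚ q)
    rw [hroot, map_zero] at h
    exact h
  have hsub : ({(q : ℂ), z, starRingEnd ℂ z} : Finset ℂ) ⊆
      ((minpoly ℚ q).aroots ℂ).toFinset := by
    intro w hw
    rw [Multiset.mem_toFinset, Polynomial.mem_aroots]
    simp only [Finset.mem_insert, Finset.mem_singleton] at hw
    rcases hw with rfl | rfl | rfl
    exacts [⟨hP, hrootq⟩, ⟨hP, hroot⟩, ⟨hP, hrootc⟩]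
  calc
    1 ≤ ∏ w ∈ ((minpoly ℚ q).aroots ℂ).toFinset, ‖w‖ :=
      one_le_prod_norm_roots_minpoly hint (by positivity)
    _ = (∏ w ∈ ((minpoly ℚ q).aroots ℂ).toFinset \ {(q : ℂ), z, starRingEnd ℂ z}, ‖w‖) *
        ∏ w ∈ ({(q : ℂ), z, starRingEnd ℂ z} : Finset ℂ), ‖w‖ := (Finset.prod_sdiff hsub).symm
    _ ≤ 1 * ∏ w ∈ ({(q : ℂ), z, starRingEnd ℂ z} : Finset ℂ), ‖w‖ := by
      gcongr
      refine Finset.prod_le_one (fun w _ => norm_nonneg w) fun w hw => (hconj w ?_ ?_).le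
      · exact (Polynomial.mem_aroots.1 (Multiset.mem_toFinset.1 (Finset.mem_sdiff.1 hw).1)).2
      · rintro rfl
        simp at hw
    _ = q * ‖z‖ ^ 2 := by
      rw [one_mul, Finset.prod_insert (by simp [hqz, hqc]), Finset.prod_pair hzc,
        Complex.norm_conj, Complex.norm_of_nonneg (by positivity), sq]

theorem stmt_0 (m : ℕ) (hm : 1 ≤ m) (q : ℝ) (hq : IsPisot q)
    (h1 : (m : ℝ) < q) (h2 : q < (m : ℝ) + 1)
    (z : ℂ) (hz : IsPisotConj q z) (him : z.im ≠ 0) :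
    1 / ((m : ℝ) + 1 / 2) ≤ ‖z‖ := by
  have hm' : (1 : ℝ) ≤ m := by exact_mod_cast hm
  have hmul := hq.one_le_mul_norm_sq hz him
  rw [div_le_iff₀ (by positivity)]
  refine (sq_le_sq₀ zero_le_one (by positivity)).1 ?_
  calc
    (1 : ℝ) ^ 2 ≤ q * ‖z‖ ^ 2 := by rwa [one_pow]
    _ ≤ ((m : ℝ) + 1 / 2) ^ 2 * ‖z‖ ^ 2 := by
      gcongr
      nlinarith
    _ = (‖z‖ * ((m : ℝ) + 1 / 2)) ^ 2 := by ring
end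

section
/- Let m ≥ 1 be an integer and let q be a Pisot number with m < q < m+1. Then q has at most one real Galois conjugate of absolute value less than 1/(m + 1/2); that is, if q'_1 and q'_2 are real Galois conjugates of q with q'_1 ≠ q'_2, then max(|q'_1|, |q'_2|) ≥ 2/(2m+1). -/
open Polynomial in
/-- The absolute norm of a nonzero algebraic integer is at least `1`: the product of the absolute
values of the complex roots of its minimal polynomial is at least `1`. -/
theorem one_le_prod_norm_aroots_minpoly {q : ℝ} (hint : IsIntegral ℤ q) (hq0 : q ≠ 0) :
    1 ≤ ∏ z ∈ ((minpoly ℚ q).aroots ℂ).toFinset, ‖z‖ := by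
  have hintQ : IsIntegral ℚ q := hint.tower_top
  have hnodup : ((minpoly ℚ q).aroots ℂ).Nodup :=
    nodup_aroots_iff_of_splits (minpoly.ne_zero hintQ) (IsAlgClosed.splits _) |>.2
      (minpoly.irreducible hintQ).separable
  have hmonic : ((minpoly ℚ q).map (algebraMap ℚ ℂ)).Monic := (minpoly.monic hintQ).map _
  have hprod := (IsAlgClosed.splits
    ((minpoly ℚ q).map (algebraMap ℚ ℂ))).coeff_zero_eq_prod_roots_of_monic hmonic
  have hcoeff : ((minpoly ℚ q).map (algebraMap ℚ ℂ)).coeff 0 = ((minpoly ℤ q).coeff 0 : ℂ) := by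
    rw [minpoly.isIntegrallyClosed_eq_field_fractions' ℚ hint]
    simp
  have hne : (minpoly ℤ q).coeff 0 ≠ 0 := fun h ↦ by
    refine minpoly.coeff_zero_ne_zero hintQ hq0 ?_
    rw [minpoly.isIntegrallyClosed_eq_field_fractions' ℚ hint, coeff_map, h, map_zero]
  have hnorm : ‖((minpoly ℤ q).coeff 0 : ℂ)‖ = (((minpoly ℚ q).aroots ℂ).map (‖·‖)).prod := by
    rw [← hcoeff, hprod, norm_mul, norm_pow, norm_neg, norm_one, one_pow, one_mul]
    exact map_multiset_prod (normHom (α := ℂ)) _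
  rw [Finset.prod, Multiset.toFinset_val, hnodup.dedup, ← hnorm, Complex.norm_intCast]
  exact_mod_cast Int.one_le_abs hne

/-- For two distinct real Galois conjugates `x`, `y` of a Pisot number `q`, `q |x| |y| ≥ 1`. -/
theorem IsPisot.one_le_mul_abs_conj {q : ℝ} (hq : IsPisot q) {x y : ℝ}
    (hx : IsPisotConj q (x : ℂ)) (hy : IsPisotConj q (y : ℂ)) (hxy : x ≠ y) :
    1 ≤ q * (|x| * |y|) := by
  obtain ⟨hq1, hint, hconj⟩ := hq
  have hintQ : IsIntegral ℚ q := hint.tower_top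
  have hmem : ∀ z : ℂ, z ∈ ((minpoly ℚ q).aroots ℂ).toFinset ↔
      Polynomial.aeval z (minpoly ℚ q) = 0 := fun z ↦ by
    rw [Multiset.mem_toFinset, Polynomial.mem_aroots, and_iff_right (minpoly.ne_zero hintQ)]
  have hroot : Polynomial.aeval (q : ℂ) (minpoly ℚ q) = 0 := by
    have h := Polynomial.aeval_algebraMap_apply ℂ q (minpoly ℚ q)
    rwa [minpoly.aeval, map_zero] at h
  have hsub : ({(q : ℂ), (x : ℂ), (y : ℂ)} : Finset ℂ) ⊆ ((minpoly ℚ q).aroots ℂ).toFinset := by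
    intro z hz
    rw [hmem]
    simp only [Finset.mem_insert, Finset.mem_singleton] at hz
    rcases hz with rfl | rfl | rfl
    exacts [hroot, hx.1, hy.1]
  have htriple : ∏ z ∈ ({(q : ℂ), (x : ℂ), (y : ℂ)} : Finset ℂ), ‖z‖ = q * (|x| * |y|) := by
    rw [Finset.prod_insert (by simpa using ⟨by simpa using hx.2.symm, by simpa using hy.2.symm⟩),
      Finset.prod_pair (by exact_mod_cast hxy)]
    simp only [Complex.norm_real, Real.norm_eq_abs]
    rw [abs_of_pos (by linarith)]
  calc 1 ≤ ∏ z ∈ ((minpoly ℚ q).aroots ℂ).toFinset, ‖z‖ :=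
        one_le_prod_norm_aroots_minpoly hint (by linarith)
    _ ≤ ∏ z ∈ ({(q : ℂ), (x : ℂ), (y : ℂ)} : Finset ℂ), ‖z‖ := by
        rw [← Finset.prod_sdiff hsub]
        refine mul_le_of_le_one_left (Finset.prod_nonneg fun _ _ ↦ norm_nonneg _)
          (Finset.prod_le_one (fun _ _ ↦ norm_nonneg _) fun z hz ↦ ?_)
        rw [Finset.mem_sdiff, hmem] at hz
        exact (hconj z hz.1 fun h ↦ hz.2 (by simp [h])).le
    _ = q * (|x| * |y|) := htriple

theorem stmt_1 (m : ℕ) (hm : 1 ≤ m) (q : ℝ) (hq : IsPisot q)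
    (h1 : (m : ℝ) < q) (h2 : q < (m : ℝ) + 1)
    (x y : ℝ) (hx : IsPisotConj q (x : ℂ)) (hy : IsPisotConj q (y : ℂ))
    (hxy : x ≠ y) :
    2 / (2 * (m : ℝ) + 1) ≤ max |x| |y| := by
  have hprod := hq.one_le_mul_abs_conj hx hy hxy
  have hm' : (1 : ℝ) ≤ m := by exact_mod_cast hm
  by_contra! hlt
  obtain ⟨hxlt, hylt⟩ := max_lt_iff.1 hlt
  have hle : |x| * |y| ≤ 2 / (2 * (m : ℝ) + 1) * (2 / (2 * (m : ℝ) + 1)) := by gcongr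
  have hbound : ((m : ℝ) + 1) * (2 / (2 * (m : ℝ) + 1) * (2 / (2 * (m : ℝ) + 1))) < 1 := by
    rw [div_mul_div_comm, ← mul_div_assoc, div_lt_one (by positivity)]
    nlinarith
  have hmul : q * (|x| * |y|) ≤
      ((m : ℝ) + 1) * (2 / (2 * (m : ℝ) + 1) * (2 / (2 * (m : ℝ) + 1))) := by gcongr
  linarith
end

section
/- Let m ≥ 1 be an integer and let q be a non-unit Pisot number with m < q < m+1, i.e. the constant coefficient of the minimal (monic integer) polynomial of q has absolute value at least 2. Then every Galois conjugate q' of q satisfies |q'| ≥ 2/(m+1). -/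
open Polynomial in
/-- If a monic separable complex polynomial has distinct roots `a`, `b` and every root other than
`a` lies in the closed unit disc, then its constant coefficient has norm at most `‖a‖ * ‖b‖`. -/
theorem norm_coeff_zero_le_mul_of_roots {P : ℂ[X]} (hP : P.Monic) (hsep : P.Separable) {a b : ℂ}
    (ha : P.IsRoot a) (hb : P.IsRoot b) (hba : b ≠ a)
    (hle : ∀ w, P.IsRoot w → w ≠ a → ‖w‖ ≤ 1) : ‖P.coeff 0‖ ≤ ‖a‖ * ‖b‖ := by
  have hnodup : P.roots.Nodup := nodup_roots hsep
  obtain ⟨T, hT⟩ := Multiset.exists_cons_of_mem ((mem_roots hP.ne_zero).2 ha)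
  have hbT : b ∈ T := by
    have h : b ∈ P.roots := (mem_roots hP.ne_zero).2 hb
    rw [hT, Multiset.mem_cons] at h
    exact h.resolve_left hba
  obtain ⟨S, rfl⟩ := Multiset.exists_cons_of_mem hbT
  have haT : a ∉ b ::ₘ S := (Multiset.nodup_cons.1 (hT ▸ hnodup)).1
  have hS : (S.map fun w => ‖w‖).prod ≤ 1 := by
    have h := Multiset.prod_map_le_prod_map₀ (s := S) (fun w => ‖w‖) (fun _ => (1 : ℝ))
      (fun w _ => norm_nonneg w) fun w hw => by
        refine hle w ((mem_roots hP.ne_zero).1 ?_) ?_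
        · rw [hT]
          exact Multiset.mem_cons_of_mem (Multiset.mem_cons_of_mem hw)
        · rintro rfl
          exact haT (Multiset.mem_cons_of_mem hw)
    simpa using h
  have hprod : ‖P.roots.prod‖ = (P.roots.map fun w => ‖w‖).prod :=
    map_multiset_prod (normHom : ℂ →*₀ ℝ) P.roots
  rw [(IsAlgClosed.splits P).coeff_zero_eq_prod_roots_of_monic hP, norm_mul, norm_pow, norm_neg,
    norm_one, one_pow, one_mul, hprod, hT, Multiset.map_cons, Multiset.map_cons,
    Multiset.prod_cons, Multiset.prod_cons, ← mul_assoc]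
  exact mul_le_of_le_one_right (by positivity) hS

theorem stmt_3 (m : ℕ) (hm : 1 ≤ m) (q : ℝ) (hq : IsPisot q)
    (h1 : (m : ℝ) < q) (h2 : q < (m : ℝ) + 1)
    (hnonunit : 2 ≤ |(minpoly ℤ q).coeff 0|)
    (z : ℂ) (hz : IsPisotConj q z) :
    2 / ((m : ℝ) + 1) ≤ ‖z‖ := by
  obtain ⟨hq1, hint, hconj⟩ := hq
  obtain ⟨hz0, hzq⟩ := hz
  have hintQ : IsIntegral ℚ q := hint.tower_top
  have hmin : minpoly ℚ q = (minpoly ℤ q).map (algebraMap ℤ ℚ) :=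
    minpoly.isIntegrallyClosed_eq_field_fractions' ℚ hint
  have hroot (w : ℂ) : ((minpoly ℚ q).map (algebraMap ℚ ℂ)).IsRoot w ↔
      Polynomial.aeval w (minpoly ℚ q) = 0 := by
    rw [Polynomial.IsRoot, Polynomial.eval_map_algebraMap]
  have hqroot : Polynomial.aeval (q : ℂ) (minpoly ℚ q) = 0 := by
    have h := Polynomial.aeval_algebraMap_apply ℂ q (minpoly ℚ q)
    rwa [minpoly.aeval, map_zero] at h
  have hnorm := norm_coeff_zero_le_mul_of_roots ((minpoly.monic hintQ).map (algebraMap ℚ ℂ))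
    ((minpoly.irreducible hintQ).separable.map) ((hroot _).2 hqroot) ((hroot z).2 hz0) hzq
    fun w hw hwq => (hconj w ((hroot w).1 hw) hwq).le
  rw [hmin, Polynomial.coeff_map, Polynomial.coeff_map, eq_intCast, eq_ratCast, Rat.cast_intCast,
    Complex.norm_intCast, Complex.norm_real, Real.norm_of_nonneg (by linarith)] at hnorm
  have h2c : (2 : ℝ) ≤ |((minpoly ℤ q).coeff 0 : ℝ)| := by exact_mod_cast hnonunit
  rw [div_le_iff₀ (by positivity)]
  nlinarith [norm_nonneg z]
end

section
/- Let m ≥ 1 be an integer and let q be a Pisot number with m < q < m+1. Suppose there exist an integer n ≥ 1 and integers a_1, …, a_n with 0 ≤ a_j ≤ m for all j and a_n ≥ 1 such that 1 = a_1/q + a_2/q² + ⋯ + a_n/qⁿ (as holds when q is a simple Parry number, i.e. when the greedy q-expansion of 1 is finite). Then every real Galois conjugate q' of q satisfies |q'| ≥ (√(m² + 4) − m)/2. -/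
open Polynomial Finset

/-- A Galois conjugate of a root `q` of `1 = ∑ b j / q ^ (j + 1)`, with nonzero last digit,
is nonzero and is a root of the same equation. -/
lemma IsPisotConj.expansion {q : ℝ} (hq : 0 < q) (N : ℕ) (b : ℕ → ℤ) (hb : b N ≠ 0)
    (hexp : 1 = ∑ j ∈ range (N + 1), (b j : ℝ) / q ^ (j + 1))
    {x : ℝ} (hx : IsPisotConj q (x : ℂ)) :
    x ≠ 0 ∧ 1 = ∑ j ∈ range (N + 1), (b j : ℝ) / x ^ (j + 1) := by
  have hdiv : ∀ y : ℝ, y ≠ 0 → y ^ (N + 1) * ∑ j ∈ range (N + 1), (b j : ℝ) / y ^ (j + 1)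
      = ∑ j ∈ range (N + 1), (b j : ℝ) * y ^ (N - j) := by
    intro y hy
    rw [mul_sum]
    refine sum_congr rfl fun j hj ↦ ?_
    have hj' : N + 1 = (N - j) + (j + 1) := by
      have := mem_range.1 hj
      omega
    rw [hj', pow_add]
    field_simp
  let p : ℚ[X] := X ^ (N + 1) - ∑ j ∈ range (N + 1), C (b j : ℚ) * X ^ (N - j)
  have hpq : aeval q p = 0 := by
    have h := hdiv q hq.ne'
    rw [← hexp, mul_one] at h
    simp [p, h]
  have hpx : aeval x p = 0 := by
    obtain ⟨r, hr⟩ := minpoly.dvd ℚ q hpq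
    have h : aeval (x : ℂ) p = 0 := by rw [hr, map_mul, hx.1, zero_mul]
    have h' : aeval (algebraMap ℝ ℂ x) p = 0 := h
    rw [aeval_algebraMap_apply] at h'
    exact (algebraMap ℝ ℂ).injective (by rw [h', map_zero])
  have hroot : x ^ (N + 1) = ∑ j ∈ range (N + 1), (b j : ℝ) * x ^ (N - j) := by
    have h := hpx
    simp only [p, map_sub, map_pow, map_sum, map_mul, aeval_X, map_intCast] at h
    linarith
  have hx0 : x ≠ 0 := by
    rintro rfl
    rw [sum_range_succ, sum_eq_zero] at hroot
    · exact hb (by simpa using hroot.symm)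
    · intro j hj
      have : N - j ≠ 0 := by
        have := mem_range.1 hj
        omega
      simp [this]
  refine ⟨hx0, mul_left_cancel₀ (pow_ne_zero (N + 1) hx0) ?_⟩
  rw [hdiv x hx0, mul_one, hroot]

/-- With nonnegative digits and nonzero last digit, `∑ b j / y ^ (j + 1)` is strictly decreasing
in `y > 0`. -/
lemma sum_div_pow_lt_of_lt (N : ℕ) (b : ℕ → ℤ) (hb0 : ∀ j, 0 ≤ b j) (hb : 1 ≤ b N)
    {x y : ℝ} (hx : 0 < x) (hxy : x < y) :
    ∑ j ∈ range (N + 1), (b j : ℝ) / y ^ (j + 1)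
      < ∑ j ∈ range (N + 1), (b j : ℝ) / x ^ (j + 1) := by
  refine sum_lt_sum (fun j _ ↦ ?_) ⟨N, self_mem_range_succ N, ?_⟩
  · have : (0 : ℝ) ≤ b j := by exact_mod_cast hb0 j
    gcongr
  · have : (0 : ℝ) < b N := by exact_mod_cast hb
    gcongr

/-- Bounds for even partial sums of an alternating polynomial with digits in `[0, m]`. -/
lemma alternating_sum_bounds (m : ℝ) (b : ℕ → ℝ) (hb0 : ∀ j, 0 ≤ b j) (hbm : ∀ j, b j ≤ m)
    {s : ℝ} (hs : 0 < s) (hms : m * s + 1 ≤ s ^ 2) (k : ℕ) :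
    1 - s ^ (2 * k) ≤ ∑ j ∈ range (2 * k), b j * (-s) ^ (j + 1) ∧
      ∑ j ∈ range (2 * k), b j * (-s) ^ (j + 1) ≤ s ^ (2 * k + 1) - s := by
  induction k with
  | zero => simp
  | succ k ih =>
    obtain ⟨hl, hu⟩ := ih
    have hP : 0 < s ^ (2 * k) := by positivity
    have hodd : (-s) ^ (2 * k + 1) = -(s ^ (2 * k) * s) := by
      rw [Odd.neg_pow ⟨k, rfl⟩, pow_succ]
    have heven : (-s) ^ (2 * k + 1 + 1) = s ^ (2 * k) * s ^ 2 := by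
      rw [Even.neg_pow ⟨k + 1, by ring⟩]; ring
    rw [show 2 * (k + 1) = 2 * k + 1 + 1 by ring, sum_range_succ, sum_range_succ, hodd, heven]
    rw [show s ^ (2 * k + 1) = s ^ (2 * k) * s by ring] at hu
    rw [show s ^ (2 * k + 1 + 1 + 1) = s ^ (2 * k) * s ^ 2 * s by ring,
      show s ^ (2 * k + 1 + 1) = s ^ (2 * k) * s ^ 2 by ring]
    set P := s ^ (2 * k)
    have e1 : P * (m * s + 1) ≤ P * s ^ 2 := by gcongr
    have e2 : P * (m * s + 1) * s ≤ P * s ^ 2 * s := by gcongr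
    have e3 : b (2 * k) * (P * s) ≤ m * (P * s) := by gcongr; exact hbm _
    have e4 : b (2 * k + 1) * (P * s ^ 2) ≤ m * (P * s ^ 2) := by gcongr; exact hbm _
    have e5 : 0 ≤ b (2 * k) * (P * s) := mul_nonneg (hb0 _) (by positivity)
    have e6 : 0 ≤ b (2 * k + 1) * (P * s ^ 2) := mul_nonneg (hb0 _) (by positivity)
    constructor <;> nlinarith

/-- An alternating polynomial with digits in `[0, m]` and last digit at least `1` does not take
the value `1` at `-s` when `s ^ 2 > m * s + 1`. -/
lemma alternating_sum_ne_one (m : ℝ) (N : ℕ) (b : ℕ → ℝ) (hb0 : ∀ j, 0 ≤ b j)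
    (hbm : ∀ j, b j ≤ m) (hb : 1 ≤ b N) {s : ℝ} (hs : 0 < s) (hms : m * s + 1 < s ^ 2) :
    ∑ j ∈ range (N + 1), b j * (-s) ^ (j + 1) ≠ 1 := by
  obtain ⟨k, rfl | rfl⟩ := N.even_or_odd'
  · obtain ⟨-, hu⟩ := alternating_sum_bounds m b hb0 hbm hs hms.le k
    rw [sum_range_succ, Odd.neg_pow ⟨k, rfl⟩]
    have : 1 * s ^ (2 * k + 1) ≤ b (2 * k) * s ^ (2 * k + 1) := by gcongr
    apply ne_of_lt
    linarith
  · obtain ⟨hl, -⟩ := alternating_sum_bounds m b hb0 hbm hs hms.le k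
    rw [sum_range_succ, sum_range_succ, Odd.neg_pow ⟨k, rfl⟩,
      Even.neg_pow (n := 2 * k + 1 + 1) ⟨k + 1, by ring⟩,
      show s ^ (2 * k + 1 + 1) = s ^ (2 * k) * s ^ 2 by ring,
      show s ^ (2 * k + 1) = s ^ (2 * k) * s by ring]
    have hP : 0 < s ^ (2 * k) := by positivity
    set P := s ^ (2 * k)
    have e1 : P * (m * s + 1) < P * s ^ 2 := by gcongr
    have e2 : b (2 * k) * (P * s) ≤ m * (P * s) := by gcongr; exact hbm _
    have e3 : 1 * (P * s ^ 2) ≤ b (2 * k + 1) * (P * s ^ 2) := by gcongr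
    apply ne_of_gt
    linarith

theorem stmt_4 (m : ℕ) (hm : 1 ≤ m) (q : ℝ) (hq : IsPisot q)
    (h1 : (m : ℝ) < q) (h2 : q < (m : ℝ) + 1)
    (n : ℕ) (hn : 1 ≤ n) (a : Fin n → ℤ)
    (ha0 : ∀ j, 0 ≤ a j) (ham : ∀ j, a j ≤ (m : ℤ))
    (halast : 1 ≤ a ⟨n - 1, by omega⟩)
    (hexp : 1 = ∑ j : Fin n, (a j : ℝ) / q ^ ((j : ℕ) + 1))
    (x : ℝ) (hx : IsPisotConj q (x : ℂ)) :
    (Real.sqrt ((m : ℝ) ^ 2 + 4) - m) / 2 ≤ |x| := by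
  obtain ⟨N, rfl⟩ : ∃ N, n = N + 1 := ⟨n - 1, by omega⟩
  let b : ℕ → ℤ := fun j ↦ if h : j < N + 1 then a ⟨j, h⟩ else 0
  have hb0 : ∀ j, 0 ≤ b j := by
    intro j
    dsimp only [b]
    split_ifs
    exacts [ha0 _, le_rfl]
  have hbm : ∀ j, b j ≤ m := by
    intro j
    dsimp only [b]
    split_ifs
    exacts [ham _, m.cast_nonneg]
  have hbN : 1 ≤ b N := by simpa [b] using halast
  have hbq : 1 = ∑ j ∈ range (N + 1), (b j : ℝ) / q ^ (j + 1) := by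
    rw [hexp, ← Fin.sum_univ_eq_sum_range (fun j ↦ (b j : ℝ) / q ^ (j + 1))]
    exact sum_congr rfl fun j _ ↦ by simp only [b, j.isLt, dif_pos]
  have hq0 : 0 < q := zero_lt_one.trans hq.1
  obtain ⟨hx0, hbx⟩ := hx.expansion hq0 N b (by omega) hbq
  have hxq : x ≠ q := fun h ↦ hx.2 (by rw [h])
  have hxneg : x < 0 := by
    refine lt_of_le_of_ne (not_lt.1 fun hxpos ↦ ?_) hx0
    rcases lt_or_gt_of_ne hxq with h | h
    · exact absurd (sum_div_pow_lt_of_lt N b hb0 hbN hxpos h) (by rw [← hbq, ← hbx]; simp)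
    · exact absurd (sum_div_pow_lt_of_lt N b hb0 hbN hq0 h) (by rw [← hbq, ← hbx]; simp)
  rw [abs_of_neg hxneg]
  by_contra! hlt
  have hsq : (-2 * x + m) ^ 2 < (m : ℝ) ^ 2 + 4 := by
    refine (Real.lt_sqrt ?_).1 (by linarith)
    have : (0 : ℝ) ≤ m := m.cast_nonneg
    linarith
  have hms : (m : ℝ) * (-x)⁻¹ + 1 < (-x)⁻¹ ^ 2 := by
    have ht : 0 < -x := by linarith
    have key : (m : ℝ) * (-x) + (-x) ^ 2 < 1 := by nlinarith
    generalize -x = t at ht key ⊢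
    have h := mul_lt_mul_of_pos_right key (show 0 < t⁻¹ ^ 2 by positivity)
    have e : ((m : ℝ) * t + t ^ 2) * t⁻¹ ^ 2 = m * t⁻¹ + 1 := by
      field_simp
    rwa [e, one_mul] at h
  refine alternating_sum_ne_one m N (fun j ↦ (b j : ℝ)) (fun j ↦ by exact_mod_cast hb0 j)
    (fun j ↦ by exact_mod_cast hbm j) (by exact_mod_cast hbN)
    (inv_pos.2 (neg_pos.2 hxneg)) hms ?_
  rw [hbx]
  exact sum_congr rfl fun j _ ↦ by rw [inv_neg, neg_neg, inv_pow, div_eq_mul_inv]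
end

section
/- Let q ∈ (1,2) be a Pisot number which is a regular Pisot number, i.e. q is a root of one of the following integer polynomials for some integers r ≥ 1, n ≥ 1 and some choice of sign ±: Φ_r(x) = x^{r+1} − 2x^r + x − 1; Ψ_r(x) = x^{r+1} − x^r − x^{r−1} − ⋯ − x − 1; χ(x) = x⁴ − x³ − 2x² + 1; Φ_r(x)·xⁿ ± (x^r − x^{r−1} + 1); Φ_r(x)·xⁿ ± (x^r − x + 1); Φ_r(x)·xⁿ ± (x^r + 1)(x − 1); Ψ_r(x)·xⁿ ± (x^{r+1} − 1); Ψ_r(x)·xⁿ ± (x^{r−1} + x^{r−2} + ⋯ + x + 1); χ(x)·xⁿ ± (x³ + x² − x − 1); χ(x)·xⁿ ± (x⁴ − x² + 1). Then every Galois conjugate q' of q satisfies |q'| ≥ (√5 − 1)/2. -/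
open Polynomial

/-- `Φ_r(x) = x^{r+1} - 2x^r + x - 1`, the minimal polynomial of the limit point `φ_r`. -/
noncomputable def PhiP (r : ℕ) : Polynomial ℤ := X ^ (r + 1) - 2 * X ^ r + X - 1

/-- `Ψ_r(x) = x^{r+1} - x^r - ⋯ - x - 1`, the minimal polynomial of the limit point `ψ_r`. -/
noncomputable def PsiP (r : ℕ) : Polynomial ℤ :=
  X ^ (r + 1) - ∑ i ∈ Finset.range (r + 1), X ^ i

/-- `χ(x) = x⁴ - x³ - 2x² + 1`, the minimal polynomial of the limit point `χ`. -/
noncomputable def chiP : Polynomial ℤ := X ^ 4 - X ^ 3 - 2 * X ^ 2 + 1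

/-- `q` is a regular Pisot number in Amara's classification: a root of one of the
defining families (for some `r ≥ 1`, `n ≥ 1` and sign `ε = ±1`) or of one of the
limit-point polynomials `Φ_r`, `Ψ_r`, `χ`. -/
def IsRegularPisotRoot (q : ℝ) : Prop :=
  ∃ r n : ℕ, 1 ≤ r ∧ 1 ≤ n ∧ ∃ ε : ℤ, (ε = 1 ∨ ε = -1) ∧
    (Polynomial.aeval q (PhiP r) = 0 ∨
     Polynomial.aeval q (PsiP r) = 0 ∨
     Polynomial.aeval q chiP = 0 ∨
     Polynomial.aeval q (PhiP r * X ^ n + C ε * (X ^ r - X ^ (r - 1) + 1)) = 0 ∨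
     Polynomial.aeval q (PhiP r * X ^ n + C ε * (X ^ r - X + 1)) = 0 ∨
     Polynomial.aeval q (PhiP r * X ^ n + C ε * ((X ^ r + 1) * (X - 1))) = 0 ∨
     Polynomial.aeval q (PsiP r * X ^ n + C ε * (X ^ (r + 1) - 1)) = 0 ∨
     Polynomial.aeval q (PsiP r * X ^ n + C ε * (∑ i ∈ Finset.range r, X ^ i)) = 0 ∨
     Polynomial.aeval q (chiP * X ^ n + C ε * (X ^ 3 + X ^ 2 - X - 1)) = 0 ∨
     Polynomial.aeval q (chiP * X ^ n + C ε * (X ^ 4 - X ^ 2 + 1)) = 0)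

section SmallDisc

variable {z : ℂ}

lemma norm_lt_of_sq_add_lt (ht : ‖z‖ ^ 2 + ‖z‖ < 1) : ‖z‖ < 619 / 1000 := by
  nlinarith [norm_nonneg z]

lemma norm_pow_le_numeral (ht : ‖z‖ ^ 2 + ‖z‖ < 1) {k n : ℕ} (h : k ≤ n) :
    ‖z‖ ^ n ≤ (619 / 1000 : ℝ) ^ k := by
  have hlt := norm_lt_of_sq_add_lt ht
  calc ‖z‖ ^ n ≤ ‖z‖ ^ k := pow_le_pow_of_le_one (norm_nonneg z) (by linarith) h
    _ ≤ _ := pow_le_pow_left₀ (norm_nonneg z) hlt.le k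

lemma norm_pow_le_norm_pow (ht : ‖z‖ ^ 2 + ‖z‖ < 1) {k n : ℕ} (h : k ≤ n) :
    ‖z‖ ^ n ≤ ‖z‖ ^ k :=
  pow_le_pow_of_le_one (norm_nonneg z) (by linarith [norm_lt_of_sq_add_lt ht]) h

lemma norm_sign {e : ℂ} (he : e = 1 ∨ e = -1) : ‖e‖ = 1 := by
  rcases he with rfl | rfl <;> simp

lemma one_sub_norm_le (a : ℂ) : 1 - ‖a‖ ≤ ‖1 - a‖ := by
  simpa using norm_sub_norm_le (1 : ℂ) a

lemma one_sub_norm_le_add (a : ℂ) : 1 - ‖a‖ ≤ ‖1 + a‖ := by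
  simpa using norm_sub_norm_le (1 : ℂ) (-a)

/-- Domination of the perturbing term `zⁿ · ∑ d i z^i` by `1 + ∑ c i z^(i+1)`, for `n ≥ k`. -/
lemma sign_mul_one_add_sum_ne (ht : ‖z‖ ^ 2 + ‖z‖ < 1) {e : ℂ} (he : e = 1 ∨ e = -1)
    {k n : ℕ} (hn : k ≤ n) {l m : ℕ} (c : Fin l → ℤ) (d : Fin m → ℤ)
    (hcd : ∑ i, |(c i : ℝ)| * (619 / 1000 : ℝ) ^ (i.val + 1) +
      (619 / 1000 : ℝ) ^ k * ∑ i, |(d i : ℝ)| * (619 / 1000 : ℝ) ^ i.val < 1) :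
    e * (1 + ∑ i, (c i : ℂ) * z ^ (i.val + 1)) ≠ z ^ n * ∑ i, (d i : ℂ) * z ^ i.val := by
  intro h
  have h1 : ‖∑ i, (c i : ℂ) * z ^ (i.val + 1)‖ ≤
      ∑ i, |(c i : ℝ)| * (619 / 1000 : ℝ) ^ (i.val + 1) := by
    refine (norm_sum_le _ _).trans (Finset.sum_le_sum fun i _ => ?_)
    rw [norm_mul, norm_pow, Complex.norm_intCast]
    exact mul_le_mul_of_nonneg_left (norm_pow_le_numeral ht le_rfl) (abs_nonneg _)
  have h2 : ‖∑ i, (d i : ℂ) * z ^ i.val‖ ≤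
      ∑ i, |(d i : ℝ)| * (619 / 1000 : ℝ) ^ i.val := by
    refine (norm_sum_le _ _).trans (Finset.sum_le_sum fun i _ => ?_)
    rw [norm_mul, norm_pow, Complex.norm_intCast]
    exact mul_le_mul_of_nonneg_left (norm_pow_le_numeral ht le_rfl) (abs_nonneg _)
  have h3 := congrArg norm h
  rw [norm_mul, norm_mul, norm_pow, norm_sign he, one_mul] at h3
  have h4 := one_sub_norm_le_add (∑ i, (c i : ℂ) * z ^ (i.val + 1))
  have h5 := mul_le_mul (norm_pow_le_numeral ht hn) h2 (norm_nonneg _) (by positivity)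
  linarith

/-- An integer polynomial with constant term `1` does not vanish at `z` if the remaining
coefficients are dominated at `0.619 > ‖z‖`. -/
lemma one_add_sum_ne_zero (ht : ‖z‖ ^ 2 + ‖z‖ < 1) {m : ℕ} (c : Fin m → ℤ)
    (hc : ∑ i, |(c i : ℝ)| * (619 / 1000 : ℝ) ^ (i.val + 1) < 1) :
    1 + ∑ i, (c i : ℂ) * z ^ (i.val + 1) ≠ 0 := by
  simpa using sign_mul_one_add_sum_ne ht (Or.inl rfl) (le_refl 0) c ![] (by simpa using hc)

lemma golden_ne_zero (ht : ‖z‖ ^ 2 + ‖z‖ < 1) : z ^ 2 - z - 1 ≠ 0 := by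
  intro h
  have h1 : (1 : ℂ) = z ^ 2 - z := by linear_combination -h
  have h2 : ‖(1 : ℂ)‖ ≤ ‖z ^ 2‖ + ‖z‖ := by
    rw [h1]; exact norm_sub_le _ _
  rw [norm_one, norm_pow] at h2
  linarith

lemma chi_ne_zero (ht : ‖z‖ ^ 2 + ‖z‖ < 1) : z ^ 4 - z ^ 3 - 2 * z ^ 2 + 1 ≠ 0 := by
  intro h
  refine one_add_sum_ne_zero ht ![0, 0, -1, -3, -2, 2] ?_ ?_
  · norm_num [Fin.sum_univ_succ]
  · norm_num [Fin.sum_univ_succ]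
    linear_combination (1 + 2 * z ^ 2) * h

lemma phi_ne_zero (ht : ‖z‖ ^ 2 + ‖z‖ < 1) {r : ℕ} (hr : 1 ≤ r) :
    z ^ (r + 1) - 2 * z ^ r + z - 1 ≠ 0 := by
  intro h
  rcases (by omega : r = 1 ∨ r = 2 ∨ 3 ≤ r) with rfl | rfl | hr
  · exact golden_ne_zero ht (by linear_combination h)
  · refine one_add_sum_ne_zero ht ![0, 1, 1, -1] ?_ ?_
    · norm_num [Fin.sum_univ_succ]
    · norm_num [Fin.sum_univ_succ]
      linear_combination (-1 - z) * h
  · have h1 : 1 - z = -z ^ r * (1 + (1 - z)) := by linear_combination -h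
    have h2 : ‖1 - z‖ ≤ ‖z‖ ^ r * (1 + ‖1 - z‖) := by
      conv_lhs => rw [h1]
      rw [norm_mul, norm_neg, norm_pow]
      gcongr
      simpa using norm_add_le (1 : ℂ) (1 - z)
    have h3 := one_sub_norm_le z
    have h4 := norm_pow_le_numeral ht hr
    have h5 := norm_lt_of_sq_add_lt ht
    nlinarith [norm_nonneg (1 - z)]

lemma psi_ne_zero (ht : ‖z‖ ^ 2 + ‖z‖ < 1) {r : ℕ} (hr : 1 ≤ r) :
    z ^ (r + 1) - ∑ i ∈ Finset.range (r + 1), z ^ i ≠ 0 := by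
  intro h
  have h1 : (1 : ℂ) = z ^ (r + 1) * (2 - z) := by
    linear_combination (-(1 - z)) * h - mul_neg_geom_sum z (r + 1)
  have h2 : (1 : ℝ) ≤ ‖z‖ ^ (r + 1) * (2 + ‖z‖) := by
    calc (1 : ℝ) = ‖(1 : ℂ)‖ := by simp
      _ = ‖z‖ ^ (r + 1) * ‖2 - z‖ := by rw [h1, norm_mul, norm_pow]
      _ ≤ _ := by
        gcongr
        simpa using norm_sub_le (2 : ℂ) z
  have h3 := norm_pow_le_norm_pow ht (by omega : 2 ≤ r + 1)
  have h4 := norm_nonneg z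
  nlinarith

/-- The case `r = 2` of the family `Φ_r xⁿ ± (x^r - x + 1)`. -/
lemma phi_two_family_ne_zero (ht : ‖z‖ ^ 2 + ‖z‖ < 1) {n : ℕ} (hn : 1 ≤ n) {e : ℂ}
    (he : e = 1 ∨ e = -1) :
    (z ^ 3 - 2 * z ^ 2 + z - 1) * z ^ n + e * (z ^ 2 - z + 1) ≠ 0 := by
  intro h
  rcases (by omega : n = 1 ∨ 2 ≤ n) with rfl | hn
  · rcases he with rfl | rfl
    · refine one_add_sum_ne_zero ht ![0, -1, 0, -1, 0, 1] ?_ ?_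
      · norm_num [Fin.sum_univ_succ]
      · norm_num [Fin.sum_univ_succ]
        linear_combination (1 + 2 * z + z ^ 2) * h
    · refine one_add_sum_ne_zero ht ![0, 0, 2, -1] ?_ ?_
      · norm_num [Fin.sum_univ_succ]
      · norm_num [Fin.sum_univ_succ]
        linear_combination (-1) * h
  · refine sign_mul_one_add_sum_ne ht he hn ![0, 0, 1] ![1, 0, 1, 1, -1] ?_ ?_
    · norm_num [Fin.sum_univ_succ]
    · norm_num [Fin.sum_univ_succ]
      linear_combination (1 + z) * h

lemma domination_two_two {t S T : ℝ} (ht0 : 0 ≤ t) (ht : t ^ 2 + t < 1) (hT0 : 0 ≤ T)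
    (hS : S ≤ t ^ 2) (hT : T ≤ t ^ 2) : S * T * (1 + t) ^ 2 < (1 - S) * (1 - T) := by
  have h1 : S * T ≤ t ^ 2 * t ^ 2 := mul_le_mul hS hT hT0 (by positivity)
  calc S * T * (1 + t) ^ 2 ≤ t ^ 2 * t ^ 2 * (1 + t) ^ 2 := by gcongr
    _ = (t * (t ^ 2 + t)) * (t * (t ^ 2 + t)) := by ring
    _ ≤ t * t := by
      have : t * (t ^ 2 + t) ≤ t := mul_le_of_le_one_right ht0 ht.le
      gcongr
    _ < (1 - S) * (1 - T) := mul_lt_mul'' (by linarith) (by linarith) ht0 ht0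

lemma domination_one_four {t T : ℝ} (ht0 : 0 ≤ t) (ht : t ^ 2 + t < 1)
    (hT : T ≤ t ^ 4) : t * T * (1 + t) ^ 2 < (1 - t) * (1 - T) := by
  have h4 : t < 1 - T := by nlinarith [sq_nonneg t]
  calc t * T * (1 + t) ^ 2 ≤ t * t ^ 4 * (1 + t) ^ 2 := by gcongr
    _ = t ^ 3 * ((t ^ 2 + t) * (t ^ 2 + t)) := by ring
    _ ≤ t ^ 3 := by
      refine mul_le_of_le_one_right (by positivity) ?_
      exact mul_le_one₀ ht.le (by positivity) ht.le
    _ = t ^ 2 * t := by ring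
    _ < (1 - t) * (1 - T) := mul_lt_mul'' (by linarith) h4 (by positivity) ht0

/-- The case `r = 1` of the family `Φ_r xⁿ ± (x^r - x + 1)`. -/
lemma phi_one_family_ne_zero (ht : ‖z‖ ^ 2 + ‖z‖ < 1) {n : ℕ} (hn : 1 ≤ n) {e : ℂ}
    (he : e = 1 ∨ e = -1) : (z ^ 2 - z - 1) * z ^ n + e ≠ 0 := by
  intro h
  rcases (by omega : n = 1 ∨ 2 ≤ n) with rfl | hn
  · rcases he with rfl | rfl
    · refine one_add_sum_ne_zero ht ![0, -2, 0, 1] ?_ ?_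
      · norm_num [Fin.sum_univ_succ]
      · norm_num [Fin.sum_univ_succ]
        linear_combination (1 + z) * h
    · refine one_add_sum_ne_zero ht ![0, 0, -2, 1] ?_ ?_
      · norm_num [Fin.sum_univ_succ]
      · norm_num [Fin.sum_univ_succ]
        linear_combination (-1 + z) * h
  · refine sign_mul_one_add_sum_ne ht he hn ![] ![1, 1, -1] ?_ ?_
    · norm_num [Fin.sum_univ_succ]
    · norm_num [Fin.sum_univ_succ]
      linear_combination h

lemma phi_family_sub_X_ne_zero (ht : ‖z‖ ^ 2 + ‖z‖ < 1) {r n : ℕ} (hr : 1 ≤ r) (hn : 1 ≤ n)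
    {e : ℂ} (he : e = 1 ∨ e = -1) :
    (z ^ (r + 1) - 2 * z ^ r + z - 1) * z ^ n + e * (z ^ r - z + 1) ≠ 0 := by
  intro h
  rcases (by omega : r = 1 ∨ r = 2 ∨ 3 ≤ r) with rfl | rfl | hr
  · exact phi_one_family_ne_zero ht hn he (by linear_combination h)
  · exact phi_two_family_ne_zero ht hn he h
  have h1 : (1 - z) * (e - z ^ n) = -z ^ r * ((e - z ^ n) - (1 - z) * z ^ n) := by
    linear_combination h
  have h2 : ‖1 - z‖ * ‖e - z ^ n‖ ≤ ‖z‖ ^ r * (‖e - z ^ n‖ + ‖1 - z‖ * ‖z‖ ^ n) := by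
    rw [← norm_mul, h1, norm_mul, norm_neg, norm_pow]
    gcongr
    refine (norm_sub_le _ _).trans ?_
    rw [norm_mul, norm_pow]
  have ha := one_sub_norm_le z
  have hb : 1 - ‖z‖ ^ n ≤ ‖e - z ^ n‖ := by
    simpa [norm_sign he] using norm_sub_norm_le e (z ^ n)
  have hS := norm_pow_le_norm_pow ht hr
  have hT := norm_pow_le_norm_pow ht hn
  rw [pow_one] at hT
  have hS0 : 0 ≤ ‖z‖ ^ r := by positivity
  have hT0 : 0 ≤ ‖z‖ ^ n := by positivity
  have ht0 := norm_nonneg z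
  have hlt := norm_lt_of_sq_add_lt ht
  have b3 := norm_pow_le_numeral ht (le_refl 3)
  norm_num at b3
  generalize ‖1 - z‖ = a at *
  generalize ‖e - z ^ n‖ = b at *
  generalize ‖z‖ ^ r = S at *
  generalize ‖z‖ ^ n = T at *
  generalize ‖z‖ = t at *
  have e1 : (1 - T) * (a - S) ≤ b * (a - S) :=
    mul_le_mul_of_nonneg_right hb (by linarith)
  have e2 : 0 ≤ 1 - T - S * T := by nlinarith
  have e3 : (1 - t) * (1 - T - S * T) ≤ a * (1 - T - S * T) :=
    mul_le_mul_of_nonneg_right ha e2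
  have e4 : S * ((1 - t) * T + (1 - T)) ≤ t ^ 3 * ((1 - t) * T + (1 - T)) := by
    refine mul_le_mul_of_nonneg_right hS ?_
    nlinarith
  have e5 : T * ((1 - t) * (1 + t ^ 3) - t ^ 3) ≤ t * ((1 - t) * (1 + t ^ 3) - t ^ 3) := by
    refine mul_le_mul_of_nonneg_right hT ?_
    nlinarith [pow_nonneg ht0 3]
  have e6 : 0 < (1 - t) * (1 - t - t ^ 2 * (t + t ^ 2)) := by
    apply mul_pos <;> nlinarith [sq_nonneg t]
  nlinarith

lemma phi_family_sub_pow_false (ht : ‖z‖ ^ 2 + ‖z‖ < 1) (hz0 : z ≠ 0) {q : ℝ} (h1q : 1 < q)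
    (hq2 : q < 2) {r n : ℕ} (hr : 1 ≤ r) (hn : 1 ≤ n) {e : ℤ} (he : e = 1 ∨ e = -1)
    (hq : (q ^ (r + 1) - 2 * q ^ r + q - 1) * q ^ n + e * (q ^ r - q ^ (r - 1) + 1) = 0)
    (h : (z ^ (r + 1) - 2 * z ^ r + z - 1) * z ^ n + e * (z ^ r - z ^ (r - 1) + 1) = 0) :
    False := by
  have heC : (e : ℂ) = 1 ∨ (e : ℂ) = -1 := by rcases he with rfl | rfl <;> simp
  obtain ⟨k, rfl⟩ : ∃ k, r = k + 1 := ⟨r - 1, by omega⟩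
  rw [Nat.add_sub_cancel] at h hq
  rcases (by omega : n = 1 ∨ 2 ≤ n) with rfl | hn
  · rcases he with rfl | rfl
    · have h' : (z ^ 3 - 2 * z ^ 2 + z - 1) * z ^ k + 1 * (z ^ 2 - z + 1) = 0 := by
        push_cast at h
        linear_combination h
      rcases Nat.eq_zero_or_pos k with rfl | hk
      · have h0 : z ^ 2 * (z - 1) = 0 := by linear_combination h'
        rcases mul_eq_zero.1 h0 with h0 | h0
        · exact hz0 (by simpa using h0)
        · have : ‖z‖ = 1 := by rw [sub_eq_zero.1 h0]; simp
          rw [this] at ht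
          norm_num at ht
      · exact phi_two_family_ne_zero ht hk (Or.inl rfl) h'
    · have hs : 1 ≤ q ^ k := one_le_pow₀ h1q.le
      have h' : q ^ k * (q ^ 2 * (2 - q) + (q - 1)) = q ^ 2 - q - 1 := by
        push_cast at hq
        linear_combination -hq
      have hpos : 0 < q ^ 2 * (2 - q) + (q - 1) := by nlinarith [sq_nonneg q]
      have := mul_le_mul_of_nonneg_right hs hpos.le
      nlinarith [mul_pos (mul_pos (by linarith : 0 < q) (by linarith : 0 < 2 - q))
        (by linarith : 0 < 1 + q)]
  rcases (by omega : k = 0 ∨ k = 1 ∨ k = 2 ∨ k = 3 ∨ 4 ≤ k) with rfl | rfl | rfl | rfl | hk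
  · obtain ⟨m, rfl⟩ : ∃ m, n = m + 1 := ⟨n - 1, by omega⟩
    refine phi_one_family_ne_zero ht (by omega : 1 ≤ m) heC (mul_left_cancel₀ hz0 ?_)
    linear_combination h
  · exact phi_two_family_ne_zero ht (by omega : 1 ≤ n) heC (by linear_combination h)
  · rcases (by omega : n = 2 ∨ n = 3 ∨ 4 ≤ n) with rfl | rfl | hn
    · rcases he with rfl | rfl
      · have h0 : (z ^ 2 - z - 1) * (-1 + z - z ^ 3 + z ^ 4) = 0 := by
          push_cast at h
          linear_combination h
        rcases mul_eq_zero.1 h0 with h0 | h0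
        · exact golden_ne_zero ht h0
        · refine one_add_sum_ne_zero ht ![0, -1, 1, 0, -1] ?_ ?_
          · norm_num [Fin.sum_univ_succ]
          · norm_num [Fin.sum_univ_succ]
            linear_combination (-1 - z) * h0
      · push_cast at h
        refine one_add_sum_ne_zero ht ![0, 0, 0, 0, 2, -1] ?_ ?_
        · norm_num [Fin.sum_univ_succ]
        · norm_num [Fin.sum_univ_succ]
          linear_combination -h
    · rcases he with rfl | rfl <;> push_cast at h
      · refine one_add_sum_ne_zero ht ![0, -1, 0, 1, 0, -2, 1] ?_ ?_
        · norm_num [Fin.sum_univ_succ]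
        · norm_num [Fin.sum_univ_succ]
          linear_combination h
      · refine one_add_sum_ne_zero ht ![0, 0, 0, -2, 4, -3, 1, 2, -5, 2] ?_ ?_
        · norm_num [Fin.sum_univ_succ]
        · norm_num [Fin.sum_univ_succ]
          linear_combination (-1 - z ^ 2 + 2 * z ^ 3) * h
    · refine sign_mul_one_add_sum_ne ht heC hn ![0, 0, 1, -1, 1] ![1, -1, 1, 1, -1, 2, -1] ?_ ?_
      · norm_num [Fin.sum_univ_succ]
      · norm_num [Fin.sum_univ_succ]
        linear_combination (1 + z ^ 2) * h
  · rcases (by omega : n = 2 ∨ 3 ≤ n) with rfl | hn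
    · rcases he with rfl | rfl <;> push_cast at h
      · refine one_add_sum_ne_zero ht ![0, -1, 0, 1, 0, -2, 1] ?_ ?_
        · norm_num [Fin.sum_univ_succ]
        · norm_num [Fin.sum_univ_succ]
          linear_combination h
      · refine one_add_sum_ne_zero ht ![0, 0, -2, 0, 2, 1, -1, -2, 1] ?_ ?_
        · norm_num [Fin.sum_univ_succ]
        · norm_num [Fin.sum_univ_succ]
          linear_combination (-1 + z ^ 2) * h
    · refine sign_mul_one_add_sum_ne ht heC hn ![0, 0, 0, 1, 0, -1, 1]
        ![1, -1, 0, 1, 1, -1, 0, 2, -1] ?_ ?_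
      · norm_num [Fin.sum_univ_succ]
      · norm_num [Fin.sum_univ_succ]
        linear_combination (1 + z ^ 3) * h
  · have h1 : e * (1 - z ^ k * (1 - z)) = z ^ n * ((1 - z) + z * z ^ k * (2 - z)) := by
      linear_combination h
    have h2 : ‖1 - z ^ k * (1 - z)‖ ≤
        ‖z‖ ^ n * ((1 + ‖z‖) + ‖z‖ * ‖z‖ ^ k * (2 + ‖z‖)) := by
      have h2' := congrArg norm h1
      rw [norm_mul, norm_mul, norm_sign heC, one_mul, norm_pow] at h2'
      rw [h2']
      gcongr
      refine (norm_add_le _ _).trans ?_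
      rw [norm_mul, norm_mul, norm_pow]
      gcongr
      · simpa using norm_sub_le 1 z
      · simpa using norm_sub_le 2 z
    have h3 : 1 - ‖z‖ ^ k * (1 + ‖z‖) ≤ ‖1 - z ^ k * (1 - z)‖ := by
      refine le_trans ?_ (one_sub_norm_le _)
      rw [norm_mul, norm_pow]
      gcongr
      simpa using norm_sub_le 1 z
    have hlt := norm_lt_of_sq_add_lt ht
    have hS := norm_pow_le_numeral ht hk
    have hT := norm_pow_le_numeral ht hn
    have h4 : ‖z‖ ^ n * ((1 + ‖z‖) + ‖z‖ * ‖z‖ ^ k * (2 + ‖z‖)) + ‖z‖ ^ k * (1 + ‖z‖) ≤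
        (619 / 1000) ^ 2 * ((1 + 619 / 1000) + 619 / 1000 * (619 / 1000) ^ 4 * (2 + 619 / 1000)) +
          (619 / 1000) ^ 4 * (1 + 619 / 1000) := by
      gcongr
    norm_num at h4
    linarith

/-- Only finitely many exponents escape the estimate common to two of the families. -/
lemma exponent_cases_of_le (ht : ‖z‖ ^ 2 + ‖z‖ < 1) {r n : ℕ} (hr : 1 ≤ r) (hn : 1 ≤ n)
    (h : (1 - ‖z‖ ^ r) * (1 - ‖z‖ ^ n) ≤ ‖z‖ ^ r * ‖z‖ ^ n * (1 + ‖z‖) ^ 2) :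
    r = 1 ∧ n = 1 ∨ r = 1 ∧ n = 2 ∨ r = 1 ∧ n = 3 ∨ r = 2 ∧ n = 1 ∨ r = 3 ∧ n = 1 := by
  by_contra hcases
  rcases (by omega : 2 ≤ r ∧ 2 ≤ n ∨ r = 1 ∧ 4 ≤ n ∨ 4 ≤ r ∧ n = 1) with
    ⟨hr, hn⟩ | ⟨rfl, hn⟩ | ⟨hr, rfl⟩
  · exact (domination_two_two (norm_nonneg z) ht (by positivity)
      (norm_pow_le_norm_pow ht hr) (norm_pow_le_norm_pow ht hn)).not_ge h
  · rw [pow_one] at h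
    exact (domination_one_four (norm_nonneg z) ht (norm_pow_le_norm_pow ht hn)).not_ge h
  · rw [pow_one] at h
    refine (domination_one_four (norm_nonneg z) ht (norm_pow_le_norm_pow ht hr)).not_ge ?_
    linarith

lemma phi_family_mul_false (ht : ‖z‖ ^ 2 + ‖z‖ < 1) {q : ℝ} (h1q : 1 < q)
    (hq2 : q < 2) {r n : ℕ} (hr : 1 ≤ r) (hn : 1 ≤ n) {e : ℤ} (he : e = 1 ∨ e = -1)
    (hq : (q ^ (r + 1) - 2 * q ^ r + q - 1) * q ^ n + e * ((q ^ r + 1) * (q - 1)) = 0)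
    (h : (z ^ (r + 1) - 2 * z ^ r + z - 1) * z ^ n + e * ((z ^ r + 1) * (z - 1)) = 0) :
    False := by
  have heC : (e : ℂ) = 1 ∨ (e : ℂ) = -1 := by rcases he with rfl | rfl <;> simp
  have h1 : (1 - z) * (1 + z ^ r) * (e + z ^ n) = -(z ^ r * z ^ n) := by
    linear_combination -h
  have hlt := norm_lt_of_sq_add_lt ht
  have hr1 : 0 ≤ 1 - ‖z‖ ^ r := by
    linarith [norm_pow_le_norm_pow ht hr, pow_one ‖z‖]
  have hn1 : 0 ≤ 1 - ‖z‖ ^ n := by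
    linarith [norm_pow_le_norm_pow ht hn, pow_one ‖z‖]
  have h2 : (1 - ‖z‖) * (1 - ‖z‖ ^ r) * (1 - ‖z‖ ^ n) ≤ ‖z‖ ^ r * ‖z‖ ^ n := by
    rw [← norm_pow] at hr1 hn1
    rw [← norm_pow, ← norm_pow, ← norm_mul, ← norm_neg (z ^ r * z ^ n), ← h1, norm_mul, norm_mul]
    have hb : 1 - ‖z ^ n‖ ≤ ‖e + z ^ n‖ := by
      have := norm_sub_norm_le (e : ℂ) (-(z ^ n))
      rwa [norm_sign heC, norm_neg, sub_neg_eq_add] at this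
    exact mul_le_mul (mul_le_mul (one_sub_norm_le z) (one_sub_norm_le_add _) hr1
      (norm_nonneg _)) hb hn1 (by positivity)
  have h3 : (1 - ‖z‖ ^ r) * (1 - ‖z‖ ^ n) ≤ ‖z‖ ^ r * ‖z‖ ^ n * (1 + ‖z‖) ^ 2 := by
    have h4 : 1 ≤ (1 - ‖z‖) * (1 + ‖z‖) ^ 2 := by nlinarith [norm_nonneg z]
    calc (1 - ‖z‖ ^ r) * (1 - ‖z‖ ^ n)
        ≤ (1 - ‖z‖ ^ r) * (1 - ‖z‖ ^ n) * ((1 - ‖z‖) * (1 + ‖z‖) ^ 2) :=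
          le_mul_of_one_le_right (mul_nonneg hr1 hn1) h4
      _ = (1 - ‖z‖) * (1 - ‖z‖ ^ r) * (1 - ‖z‖ ^ n) * (1 + ‖z‖) ^ 2 := by ring
      _ ≤ _ := by gcongr
  rcases exponent_cases_of_le ht hr hn h3 with ⟨rfl, rfl⟩ | ⟨rfl, rfl⟩ | ⟨rfl, rfl⟩ |
    ⟨rfl, rfl⟩ | ⟨rfl, rfl⟩
  · rcases he with rfl | rfl <;> push_cast at h hq
    · refine one_add_sum_ne_zero ht ![1, 0, -1] ?_ ?_
      · norm_num [Fin.sum_univ_succ]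
      · norm_num [Fin.sum_univ_succ]
        linear_combination -h
    · nlinarith [mul_pos (mul_pos (by linarith : 0 < q) (by linarith : 0 < q))
        (by linarith : 0 < 2 - q)]
  · rcases he with rfl | rfl <;> push_cast at h
    · refine one_add_sum_ne_zero ht ![0, 0, 1, -1] ?_ ?_
      · norm_num [Fin.sum_univ_succ]
      · norm_num [Fin.sum_univ_succ]
        linear_combination -h
    · exact chi_ne_zero ht (by linear_combination h)
  · rcases he with rfl | rfl <;> push_cast at h
    · refine one_add_sum_ne_zero ht ![0, -1, 1, 1, -1] ?_ ?_
      · norm_num [Fin.sum_univ_succ]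
      · norm_num [Fin.sum_univ_succ]
        linear_combination -h
    · refine one_add_sum_ne_zero ht ![0, -1, -1, -1, 1] ?_ ?_
      · norm_num [Fin.sum_univ_succ]
      · norm_num [Fin.sum_univ_succ]
        linear_combination h
  · rcases he with rfl | rfl <;> push_cast at h hq
    · refine one_add_sum_ne_zero ht ![0, 0, 1, -1] ?_ ?_
      · norm_num [Fin.sum_univ_succ]
      · norm_num [Fin.sum_univ_succ]
        linear_combination -h
    · nlinarith [mul_pos (mul_pos (mul_pos (by linarith : 0 < q) (by linarith : 0 < q))
        (by linarith : 0 < q)) (by linarith : 0 < 2 - q), mul_pos (mul_pos (by linarith : 0 < q)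
          (by linarith : 0 < q)) (by linarith : 0 < q - 1)]
  · rcases he with rfl | rfl <;> push_cast at h
    · refine one_add_sum_ne_zero ht ![0, -1, 1, 1, -1] ?_ ?_
      · norm_num [Fin.sum_univ_succ]
      · norm_num [Fin.sum_univ_succ]
        linear_combination -h
    · refine one_add_sum_ne_zero ht ![0, 0, 0, 0, -7, 0, -2, -9, 4] ?_ ?_
      · norm_num [Fin.sum_univ_succ]
      · norm_num [Fin.sum_univ_succ]
        linear_combination (1 + 2 * z + 3 * z ^ 2 + 3 * z ^ 3 + 4 * z ^ 4) * h

lemma psi_family_geom_false (ht : ‖z‖ ^ 2 + ‖z‖ < 1) {q : ℝ} (h1q : 1 < q)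
    (hq2 : q < 2) {r n : ℕ} (hr : 1 ≤ r) (hn : 1 ≤ n) {e : ℤ} (he : e = 1 ∨ e = -1)
    (hq : (q ^ (r + 1) - ∑ i ∈ Finset.range (r + 1), q ^ i) * q ^ n +
      e * ∑ i ∈ Finset.range r, q ^ i = 0)
    (h : (z ^ (r + 1) - ∑ i ∈ Finset.range (r + 1), z ^ i) * z ^ n +
      e * ∑ i ∈ Finset.range r, z ^ i = 0) :
    False := by
  have heC : (e : ℂ) = 1 ∨ (e : ℂ) = -1 := by rcases he with rfl | rfl <;> simp
  have h1 : (1 - z ^ r) * (e - z ^ n) = z ^ r * z ^ n * (1 - z) ^ 2 := by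
    linear_combination (1 - z) * h + z ^ n * mul_neg_geom_sum z (r + 1) -
      e * mul_neg_geom_sum z r
  have hlt := norm_lt_of_sq_add_lt ht
  have h3 : (1 - ‖z‖ ^ r) * (1 - ‖z‖ ^ n) ≤ ‖z‖ ^ r * ‖z‖ ^ n * (1 + ‖z‖) ^ 2 := by
    calc (1 - ‖z‖ ^ r) * (1 - ‖z‖ ^ n) ≤ ‖1 - z ^ r‖ * ‖e - z ^ n‖ := by
          have hb := norm_sub_norm_le (e : ℂ) (z ^ n)
          rw [norm_sign heC, norm_pow] at hb
          have ha := one_sub_norm_le (z ^ r)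
          rw [norm_pow] at ha
          refine mul_le_mul ha hb ?_ (norm_nonneg _)
          linarith [norm_pow_le_norm_pow ht hn, pow_one ‖z‖]
      _ = ‖z‖ ^ r * ‖z‖ ^ n * ‖1 - z‖ ^ 2 := by
          rw [← norm_mul, h1, norm_mul, norm_mul, norm_pow, norm_pow, norm_pow]
      _ ≤ _ := by
          gcongr
          simpa using norm_sub_le 1 z
  rcases exponent_cases_of_le ht hr hn h3 with ⟨rfl, rfl⟩ | ⟨rfl, rfl⟩ | ⟨rfl, rfl⟩ |
    ⟨rfl, rfl⟩ | ⟨rfl, rfl⟩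
  all_goals simp only [Finset.sum_range_succ, Finset.sum_range_zero] at h hq
  · rcases he with rfl | rfl <;> push_cast at h
    · refine one_add_sum_ne_zero ht ![0, -2, 0, 1] ?_ ?_
      · norm_num [Fin.sum_univ_succ]
      · norm_num [Fin.sum_univ_succ]
        linear_combination (1 + z) * h
    · refine one_add_sum_ne_zero ht ![0, 0, -2, 1] ?_ ?_
      · norm_num [Fin.sum_univ_succ]
      · norm_num [Fin.sum_univ_succ]
        linear_combination (-1 + z) * h
  · rcases he with rfl | rfl <;> push_cast at h
    · refine one_add_sum_ne_zero ht ![0, -1, -1, 1] ?_ ?_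
      · norm_num [Fin.sum_univ_succ]
      · norm_num [Fin.sum_univ_succ]
        linear_combination h
    · refine one_add_sum_ne_zero ht ![0, 1, 1, -1] ?_ ?_
      · norm_num [Fin.sum_univ_succ]
      · norm_num [Fin.sum_univ_succ]
        linear_combination -h
  · rcases he with rfl | rfl <;> push_cast at h
    · refine one_add_sum_ne_zero ht ![0, 0, -1, -1, 1] ?_ ?_
      · norm_num [Fin.sum_univ_succ]
      · norm_num [Fin.sum_univ_succ]
        linear_combination h
    · refine one_add_sum_ne_zero ht ![0, 0, 1, 1, -1] ?_ ?_
      · norm_num [Fin.sum_univ_succ]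
      · norm_num [Fin.sum_univ_succ]
        linear_combination -h
  · rcases he with rfl | rfl <;> push_cast at h hq
    · refine one_add_sum_ne_zero ht ![0, -1, -1, 1] ?_ ?_
      · norm_num [Fin.sum_univ_succ]
      · norm_num [Fin.sum_univ_succ]
        linear_combination h
    · have h3 : 0 < q ^ 3 * (2 - q) := mul_pos (by positivity) (by linarith)
      have h4 : 0 < q ^ 2 * (2 - q) := mul_pos (by positivity) (by linarith)
      nlinarith
  · rcases he with rfl | rfl <;> push_cast at h
    · refine one_add_sum_ne_zero ht ![0, 0, -1, -1, 1] ?_ ?_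
      · norm_num [Fin.sum_univ_succ]
      · norm_num [Fin.sum_univ_succ]
        linear_combination h
    · refine one_add_sum_ne_zero ht ![0, 0, 0, 1, -3, 3, -3, 1] ?_ ?_
      · norm_num [Fin.sum_univ_succ]
      · norm_num [Fin.sum_univ_succ]
        linear_combination (-1 + 2 * z - 2 * z ^ 2 + z ^ 3) * h

lemma psi_family_pow_false (ht : ‖z‖ ^ 2 + ‖z‖ < 1) {q : ℝ} (h1q : 1 < q)
    (hq2 : q < 2) {r n : ℕ} (hr : 1 ≤ r) (hn : 1 ≤ n) {e : ℤ} (he : e = 1 ∨ e = -1)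
    (hq : (q ^ (r + 1) - ∑ i ∈ Finset.range (r + 1), q ^ i) * q ^ n +
      e * (q ^ (r + 1) - 1) = 0)
    (h : (z ^ (r + 1) - ∑ i ∈ Finset.range (r + 1), z ^ i) * z ^ n +
      e * (z ^ (r + 1) - 1) = 0) :
    False := by
  have heC : (e : ℂ) = 1 ∨ (e : ℂ) = -1 := by rcases he with rfl | rfl <;> simp
  have h1 : (z ^ n + e * (1 - z)) * (1 - z ^ (r + 1)) = z ^ (r + 1) * (1 - z) * z ^ n := by
    linear_combination (-(1 - z)) * h - z ^ n * mul_neg_geom_sum z (r + 1)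
  have hq1 : (q ^ n + e * (1 - q)) * (1 - q ^ (r + 1)) = q ^ (r + 1) * (1 - q) * q ^ n := by
    linear_combination (-(1 - q)) * hq - q ^ n * mul_neg_geom_sum q (r + 1)
  have hlt := norm_lt_of_sq_add_lt ht
  have ht0 := norm_nonneg z
  have hU0 : 0 ≤ ‖z‖ ^ (r + 1) := by positivity
  have hU := norm_pow_le_norm_pow ht (by omega : 2 ≤ r + 1)
  have hU1 := one_sub_norm_le (z ^ (r + 1))
  rw [norm_pow] at hU1
  rcases (by omega : n = 1 ∨ n = 2 ∨ 3 ≤ n) with rfl | rfl | hn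
  · rcases he with rfl | rfl <;> push_cast at h1 hq1
    · have h2 : (1 : ℂ) = z ^ (r + 1) * (1 + z - z ^ 2) := by linear_combination h1
      have h3 : 1 ≤ ‖z‖ ^ (r + 1) * (1 + ‖z‖ + ‖z‖ ^ 2) := by
        calc 1 = ‖z‖ ^ (r + 1) * ‖1 + z - z ^ 2‖ := by
              rw [← norm_pow, ← norm_mul, ← h2, norm_one]
          _ ≤ _ := by
            gcongr
            refine (norm_sub_le _ _).trans ?_
            rw [norm_pow]
            gcongr
            simpa using norm_add_le 1 z
      nlinarith
    · have hs : q ^ 2 ≤ q ^ (r + 1) := pow_le_pow_right₀ h1q.le (by omega)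
      nlinarith [mul_pos (sub_pos.2 h1q) (sub_pos.2 hq2)]
  · rcases he with rfl | rfl <;> push_cast at h1 hq1
    · have h2 : (1 + z ^ 3) * (1 - z ^ (r + 1)) = z ^ (r + 1) * z ^ 2 * (1 - z ^ 2) := by
        linear_combination (1 + z) * h1
      have h3 : (1 - ‖z‖ ^ 3) * (1 - ‖z‖ ^ (r + 1)) ≤
          ‖z‖ ^ (r + 1) * ‖z‖ ^ 2 * (1 + ‖z‖ ^ 2) := by
        calc (1 - ‖z‖ ^ 3) * (1 - ‖z‖ ^ (r + 1)) ≤ ‖1 + z ^ 3‖ * ‖1 - z ^ (r + 1)‖ := by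
              have ha := one_sub_norm_le_add (z ^ 3)
              rw [norm_pow] at ha
              exact mul_le_mul ha hU1 (by nlinarith) (norm_nonneg _)
          _ = ‖z‖ ^ (r + 1) * ‖z‖ ^ 2 * ‖1 - z ^ 2‖ := by
              rw [← norm_mul, h2, norm_mul, norm_mul, norm_pow, norm_pow]
          _ ≤ _ := by
              gcongr
              have hd := norm_sub_le (1 : ℂ) (z ^ 2)
              rwa [norm_one, norm_pow] at hd
      have b2 := norm_pow_le_numeral ht (le_refl 2)
      have b3 := norm_pow_le_numeral ht (le_refl 3)
      have bU := norm_pow_le_numeral ht (by omega : 2 ≤ r + 1)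
      have h4 : ‖z‖ ^ (r + 1) * ‖z‖ ^ 2 * (1 + ‖z‖ ^ 2) ≤
          (619 / 1000) ^ 2 * (619 / 1000) ^ 2 * (1 + (619 / 1000) ^ 2) := by gcongr
      have h5 : (1 - (619 / 1000 : ℝ) ^ 3) * (1 - (619 / 1000) ^ 2) ≤
          (1 - ‖z‖ ^ 3) * (1 - ‖z‖ ^ (r + 1)) := by
        refine mul_le_mul (by linarith) (by linarith) (by norm_num) ?_
        norm_num at b3 ⊢
        linarith
      norm_num at h4 h5
      linarith
    · rcases (by omega : r = 1 ∨ 2 ≤ r) with rfl | hr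
      · refine chi_ne_zero ht ?_
        simp only [Finset.sum_range_succ, Finset.sum_range_zero] at h
        push_cast at h
        linear_combination h
      · have hs : q ^ 3 ≤ q ^ (r + 1) := pow_le_pow_right₀ h1q.le (by omega)
        have h2 : q ^ (r + 1) * (1 + (2 - q) * (q ^ 2 - 1)) = q ^ 2 + q - 1 := by
          linear_combination -hq1
        have h3 : 0 < (2 - q) * (q ^ 2 - 1) := mul_pos (by linarith) (by nlinarith)
        have h4 : 0 < (q - 1) ^ 2 * (q + 1) := by
          have := sub_pos.2 h1q
          positivity
        have h5 : 0 < q ^ (r + 1) := by positivity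
        nlinarith
  · have hT := norm_pow_le_norm_pow ht hn
    have hT0 : 0 ≤ ‖z‖ ^ n := by positivity
    have ha := one_sub_norm_le z
    have h2 : (‖1 - z‖ - ‖z‖ ^ n) * (1 - ‖z‖ ^ (r + 1)) ≤
        ‖z‖ ^ (r + 1) * ‖1 - z‖ * ‖z‖ ^ n := by
      calc (‖1 - z‖ - ‖z‖ ^ n) * (1 - ‖z‖ ^ (r + 1))
          ≤ ‖z ^ n + e * (1 - z)‖ * ‖1 - z ^ (r + 1)‖ := by
            have hb := norm_sub_norm_le ((e : ℂ) * (1 - z)) (-(z ^ n))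
            rw [norm_mul, norm_sign heC, one_mul, norm_neg, norm_pow, sub_neg_eq_add,
              add_comm] at hb
            exact mul_le_mul hb hU1 (by nlinarith) (norm_nonneg _)
        _ = _ := by rw [← norm_mul, h1, norm_mul, norm_mul, norm_pow, norm_pow]
    generalize ‖1 - z‖ = a at *
    generalize ‖z‖ ^ (r + 1) = U at *
    generalize ‖z‖ ^ n = T at *
    generalize ‖z‖ = t at *
    have e1 : U * T ≤ t ^ 2 * t ^ 3 := mul_le_mul hU hT hT0 (by positivity)
    have e2 : 0 ≤ 1 - U - U * T := by nlinarith [pow_nonneg ht0 3]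
    have e3 : (1 - t) * (1 - U - U * T) ≤ a * (1 - U - U * T) :=
      mul_le_mul_of_nonneg_right ha e2
    have e4 : (1 - t) * (U * T) ≤ (1 - t) * (t ^ 2 * t ^ 3) :=
      mul_le_mul_of_nonneg_left e1 (by linarith)
    have e5 : t * (t ^ 2 * (1 - t)) < (1 - U) * (1 - t - T) :=
      mul_lt_mul'' (by linarith) (by nlinarith) ht0 (mul_nonneg (by positivity) (by linarith))
    have e6 : (1 - t) * t ^ 5 ≤ (1 - t) * t ^ 3 :=
      mul_le_mul_of_nonneg_left (pow_le_pow_of_le_one ht0 (by linarith) (by norm_num))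
        (by linarith)
    linarith

lemma chi_family_false (ht : ‖z‖ ^ 2 + ‖z‖ < 1) {q : ℝ} (h1q : 1 < q) (hq2 : q < 2)
    {n : ℕ} (hn : 1 ≤ n) {e : ℤ} (he : e = 1 ∨ e = -1)
    (hq : (q ^ 4 - q ^ 3 - 2 * q ^ 2 + 1) * q ^ n + e * (q ^ 3 + q ^ 2 - q - 1) = 0)
    (h : (z ^ 4 - z ^ 3 - 2 * z ^ 2 + 1) * z ^ n + e * (z ^ 3 + z ^ 2 - z - 1) = 0) :
    False := by
  have heC : (e : ℂ) = 1 ∨ (e : ℂ) = -1 := by rcases he with rfl | rfl <;> simp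
  rcases (by omega : n = 1 ∨ n = 2 ∨ n = 3 ∨ 4 ≤ n) with rfl | rfl | rfl | hn
  · rcases he with rfl | rfl <;> push_cast at h hq
    · refine one_add_sum_ne_zero ht ![0, -1, 1, 1, -1] ?_ ?_
      · norm_num [Fin.sum_univ_succ]
      · norm_num [Fin.sum_univ_succ]
        linear_combination -h
    · have h3 : 0 < q ^ 4 * (2 - q) := mul_pos (by positivity) (by linarith)
      have h4 : 0 < q ^ 3 * (2 - q) := mul_pos (by positivity) (by linarith)
      have h5 : 0 < q ^ 2 * (q - 1) := mul_pos (by positivity) (by linarith)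
      nlinarith
  · rcases he with rfl | rfl <;> push_cast at h
    · have h0 : (z ^ 2 - z - 1) * (1 - z ^ 2 + z ^ 4) = 0 := by linear_combination h
      rcases mul_eq_zero.1 h0 with h0 | h0
      · exact golden_ne_zero ht h0
      · refine one_add_sum_ne_zero ht ![0, -1, 0, 1] ?_ ?_
        · norm_num [Fin.sum_univ_succ]
        · norm_num [Fin.sum_univ_succ]
          linear_combination h0
    · refine one_add_sum_ne_zero ht ![0, 0, 0, -1, 0, 0, -2, 1] ?_ ?_
      · norm_num [Fin.sum_univ_succ]
      · norm_num [Fin.sum_univ_succ]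
        linear_combination (1 - z + z ^ 2) * h
  · rcases he with rfl | rfl <;> push_cast at h
    · refine one_add_sum_ne_zero ht ![0, 0, 1, 0, -2, -1, 2, 3, -2] ?_ ?_
      · norm_num [Fin.sum_univ_succ]
      · norm_num [Fin.sum_univ_succ]
        linear_combination (-1 + z - 2 * z ^ 2) * h
    · refine one_add_sum_ne_zero ht ![0, 0, 0, 0, 0, -10, 4, 3, -5, 4, 11, -6] ?_ ?_
      · norm_num [Fin.sum_univ_succ]
      · norm_num [Fin.sum_univ_succ]
        linear_combination (1 - z + 2 * z ^ 2 - 3 * z ^ 3 + 5 * z ^ 4 - 6 * z ^ 5) * h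
  · refine sign_mul_one_add_sum_ne ht heC hn ![0, -1, 0, -1, 0, 1]
      ![1, -1, -1, 0, 0, 0, 2, -1] ?_ ?_
    · norm_num [Fin.sum_univ_succ]
    · norm_num [Fin.sum_univ_succ]
      linear_combination (-(1 + z ^ 2) * (1 - z)) * h

lemma chi_family_cyclotomic_ne_zero (ht : ‖z‖ ^ 2 + ‖z‖ < 1) {n : ℕ} (hn : 1 ≤ n) {e : ℂ}
    (he : e = 1 ∨ e = -1) :
    (z ^ 4 - z ^ 3 - 2 * z ^ 2 + 1) * z ^ n + e * (z ^ 4 - z ^ 2 + 1) ≠ 0 := by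
  intro h
  rcases (by omega : n = 1 ∨ 2 ≤ n) with rfl | hn
  · rcases he with rfl | rfl
    · refine one_add_sum_ne_zero ht ![0, 0, 1, 0, -3, -1, 2] ?_ ?_
      · norm_num [Fin.sum_univ_succ]
      · norm_num [Fin.sum_univ_succ]
        linear_combination (1 - z + 2 * z ^ 2) * h
    · refine one_add_sum_ne_zero ht ![0, 0, 0, 1, 4, 5, 0, -1] ?_ ?_
      · norm_num [Fin.sum_univ_succ]
      · norm_num [Fin.sum_univ_succ]
        linear_combination (-1 - z - 2 * z ^ 2 - z ^ 3) * h
  · refine sign_mul_one_add_sum_ne ht he hn ![0, 0, 0, 0, 0, 1]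
      ![-1, 0, 1, 1, 1, 1, -1] ?_ ?_
    · norm_num [Fin.sum_univ_succ]
    · norm_num [Fin.sum_univ_succ]
      linear_combination (1 + z ^ 2) * h

end SmallDisc

lemma IsPisotConj.aeval_eq_zero {q : ℝ} {z : ℂ} (hz : IsPisotConj q z) {p : ℤ[X]}
    (hp : aeval q p = 0) : aeval z p = 0 := by
  have h1 : aeval q (p.map (algebraMap ℤ ℚ)) = 0 := by rwa [aeval_map_algebraMap]
  obtain ⟨g, hg⟩ := minpoly.dvd ℚ q h1
  rw [← aeval_map_algebraMap ℚ, hg, map_mul, hz.1, zero_mul]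

lemma IsPisotConj.ne_zero {q : ℝ} {z : ℂ} (hz : IsPisotConj q z) (hq : IsIntegral ℤ q)
    (hq0 : q ≠ 0) : z ≠ 0 := by
  rintro rfl
  have h := hz.1
  rw [← coeff_zero_eq_aeval_zero'] at h
  exact minpoly.coeff_zero_ne_zero hq.tower_top hq0 (by simpa using h)

theorem stmt_8 (q : ℝ) (hq : IsPisot q) (h1 : 1 < q) (h2 : q < 2)
    (hreg : IsRegularPisotRoot q)
    (z : ℂ) (hz : IsPisotConj q z) :
    (Real.sqrt 5 - 1) / 2 ≤ ‖z‖ := by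
  by_contra! hlt
  have ht : ‖z‖ ^ 2 + ‖z‖ < 1 := by
    nlinarith [norm_nonneg z, Real.sq_sqrt (by norm_num : (0 : ℝ) ≤ 5), Real.sqrt_nonneg 5]
  have hz0 := hz.ne_zero hq.2.1 (by linarith)
  obtain ⟨r, n, hr, hn, e, he, h⟩ := hreg
  have heC : (e : ℂ) = 1 ∨ (e : ℂ) = -1 := by rcases he with rfl | rfl <;> simp
  rcases h with h | h | h | h | h | h | h | h | h | h
  all_goals
    have h' := hz.aeval_eq_zero h
    simp only [PhiP, PsiP, chiP, map_add, map_sub, map_mul, map_pow, map_sum, map_one, map_ofNat,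
      aeval_X, map_intCast, eq_intCast] at h h'
  · exact phi_ne_zero ht hr h'
  · exact psi_ne_zero ht hr h'
  · exact chi_ne_zero ht h'
  · exact phi_family_sub_pow_false ht hz0 h1 h2 hr hn he h h'
  · exact phi_family_sub_X_ne_zero ht hr hn heC h'
  · exact phi_family_mul_false ht h1 h2 hr hn he h h'
  · exact psi_family_pow_false ht h1 h2 hr hn he h h'
  · exact psi_family_geom_false ht h1 h2 hr hn he h h'
  · exact chi_family_false ht h1 h2 hn he h h'
  · exact chi_family_cyclotomic_ne_zero ht hn heC h'
end

section
/- Let f and g be polynomials with complex coefficients with f ≠ 0, and let q ∈ ℂ with |q| > 1 and f(q) = 0. Then there exist N ∈ ℕ and complex numbers q_n for n ≥ N such that f(q_n)·q_nⁿ + g(q_n) = 0 for every n ≥ N and q_n → q as n → ∞. -/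
open Filter Metric Topology

/-- A holomorphic function on a disc which is smaller at the centre than everywhere on the
boundary circle has a zero in the closed disc. -/
theorem DiffContOnCl.exists_mem_closedBall_eq_zero {F : ℂ → ℂ} {q : ℂ} {r c : ℝ} (hr : 0 < r)
    (hF : DiffContOnCl ℂ F (ball q r)) (hq : ‖F q‖ < c) (hc : ∀ z ∈ sphere q r, c ≤ ‖F z‖) :
    ∃ z ∈ closedBall q r, F z = 0 := by
  by_contra! hne
  have hc0 : 0 < c := (norm_nonneg _).trans_lt hq
  have hFq : F q ≠ 0 := hne q (mem_closedBall_self hr.le)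
  have hinv : DiffContOnCl ℂ (F⁻¹) (ball q r) :=
    hF.inv fun z hz => hne z (closure_ball_subset_closedBall hz)
  have hle : ‖F⁻¹ q‖ ≤ c⁻¹ := by
    refine Complex.norm_le_of_forall_mem_frontier_norm_le isBounded_ball hinv (fun z hz => ?_)
      (subset_closure (mem_ball_self hr))
    rw [frontier_ball q hr.ne'] at hz
    rw [Pi.inv_apply, norm_inv]
    exact inv_anti₀ hc0 (hc z hz)
  rw [Pi.inv_apply, norm_inv, inv_le_inv₀ (norm_pos_iff.2 hFq) hc0] at hle
  exact hle.not_gt hq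

/-- The roots of a nonzero polynomial are isolated. -/
theorem Polynomial.exists_pos_forall_dist_lt_eval_ne_zero {f : Polynomial ℂ} (hf : f ≠ 0)
    (q : ℂ) : ∃ δ > 0, ∀ z, dist z q < δ → z ≠ q → f.eval z ≠ 0 := by
  classical
  have hmem : (↑(f.roots.toFinset.erase q) : Set ℂ)ᶜ ∈ 𝓝 q :=
    (Finset.finite_toSet _).isClosed.isOpen_compl.mem_nhds (by simp)
  obtain ⟨δ, hδ, hsub⟩ := Metric.mem_nhds_iff.1 hmem
  refine ⟨δ, hδ, fun z hz hzq h0 => hsub (mem_ball.2 hz) ?_⟩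
  simp [hzq, hf, h0]

/-- Near a root `q` of `f` outside the closed unit disc, `f(x) xⁿ + g(x)` has a root for all
large `n`. -/
theorem Polynomial.eventually_exists_root_mem_closedBall {f : Polynomial ℂ} (g : Polynomial ℂ)
    (hf : f ≠ 0) {q : ℂ} (hq : 1 < ‖q‖) (hroot : f.eval q = 0) {ε : ℝ} (hε : 0 < ε) :
    ∀ᶠ n : ℕ in atTop, ∃ z ∈ closedBall q ε, f.eval z * z ^ n + g.eval z = 0 := by
  obtain ⟨δ, hδ, hδf⟩ := exists_pos_forall_dist_lt_eval_ne_zero hf q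
  obtain ⟨r, hr, hrlt⟩ := exists_between (lt_min hε (lt_min hδ (sub_pos.2 hq)))
  obtain ⟨hrε, hrδ, hrq⟩ : r < ε ∧ r < δ ∧ r < ‖q‖ - 1 := by simpa using hrlt
  set ρ := ‖q‖ - r with hρdef
  have hρ : 1 < ρ := by linarith
  have hρ0 : 0 < ρ := by linarith
  have hnorm : ∀ z ∈ closedBall q r, ρ ≤ ‖z‖ := fun z hz => by
    have := norm_sub_norm_le q z
    rw [mem_closedBall, dist_comm, dist_eq_norm] at hz
    linarith
  obtain ⟨m, hm, hmf⟩ : ∃ m > 0, ∀ z ∈ sphere q r, m ≤ ‖f.eval z‖ := by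
    obtain ⟨w, hw, hmin⟩ := (isCompact_sphere q r).exists_isMinOn
      (NormedSpace.sphere_nonempty.2 hr.le) f.continuous.norm.continuousOn
    exact ⟨‖f.eval w‖, norm_pos_iff.2 (hδf w ((mem_sphere.1 hw).trans_lt hrδ)
      (ne_of_mem_sphere hw hr.ne')), fun z hz => hmin hz⟩
  obtain ⟨G, hG⟩ := (isCompact_closedBall q r).exists_bound_of_continuousOn
    g.continuous.continuousOn
  have hlim : Tendsto (fun n : ℕ => G * ρ⁻¹ ^ n) atTop (𝓝 0) := by
    simpa using (tendsto_pow_atTop_nhds_zero_of_lt_one (inv_nonneg.2 hρ0.le)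
      (inv_lt_one_of_one_lt₀ hρ)).const_mul G
  filter_upwards [hlim.eventually_lt_const (half_pos hm)] with n hn
  have hz0 : ∀ z ∈ closedBall q r, z ≠ 0 := fun z hz =>
    norm_pos_iff.1 (hρ0.trans_le (hnorm z hz))
  have hsmall : ∀ z ∈ closedBall q r, ‖g.eval z * z⁻¹ ^ n‖ < m / 2 := fun z hz => by
    refine lt_of_le_of_lt ?_ hn
    rw [norm_mul, norm_pow, norm_inv]
    have := hnorm z hz
    have := hG z hz
    have := (norm_nonneg _).trans this
    gcongr
  have hdiff : DiffContOnCl ℂ (fun z => f.eval z + g.eval z * z⁻¹ ^ n) (ball q r) := by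
    refine DifferentiableOn.diffContOnCl fun z hz => ?_
    have := hz0 z (closure_ball_subset_closedBall hz)
    exact (f.differentiable z |>.add
      ((g.differentiable z).mul ((differentiableAt_inv this).pow n))).differentiableWithinAt
  obtain ⟨z, hz, hFz⟩ := hdiff.exists_mem_closedBall_eq_zero hr (c := m / 2)
    (by simpa [hroot] using hsmall q (mem_closedBall_self hr.le)) fun z hz => by
      have h1 := hmf z hz
      have h2 := hsmall z (sphere_subset_closedBall hz)
      have h3 := norm_sub_le_norm_add (f.eval z) (g.eval z * z⁻¹ ^ n)
      linarith
  refine ⟨z, closedBall_subset_closedBall hrε.le hz, ?_⟩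
  have hzn : z⁻¹ ^ n * z ^ n = 1 := by rw [← mul_pow, inv_mul_cancel₀ (hz0 z hz), one_pow]
  linear_combination z ^ n * hFz - g.eval z * hzn

theorem stmt_9 (f g : Polynomial ℂ) (hf : f ≠ 0) (q : ℂ)
    (hq : 1 < ‖q‖) (hroot : f.eval q = 0) :
    ∃ (N : ℕ) (s : ℕ → ℂ),
      (∀ n : ℕ, N ≤ n → f.eval (s n) * (s n) ^ n + g.eval (s n) = 0) ∧
      Filter.Tendsto s Filter.atTop (nhds q) := by
  have hev : ∀ ε > 0, ∀ᶠ n : ℕ in atTop,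
      ∃ z ∈ closedBall q ε, f.eval z * z ^ n + g.eval z = 0 := fun ε hε =>
    f.eventually_exists_root_mem_closedBall g hf hq hroot hε
  let S : ℕ → Set ℂ := fun n => {z | f.eval z * z ^ n + g.eval z = 0}
  have hclosed : ∀ n, IsClosed (S n) := fun n =>
    isClosed_eq ((f.continuous.mul (continuous_pow n)).add g.continuous) continuous_const
  have hnearest : ∀ n, ∃ z, (S n).Nonempty → z ∈ S n ∧ infDist q (S n) = dist q z := fun n => by
    by_cases h : (S n).Nonempty
    · obtain ⟨z, hz⟩ := (hclosed n).exists_infDist_eq_dist h q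
      exact ⟨z, fun _ => hz⟩
    · exact ⟨0, fun h' => (h h').elim⟩
  choose s hs using hnearest
  obtain ⟨N, hN⟩ := eventually_atTop.1 (hev 1 one_pos)
  refine ⟨N, s, fun n hn => ?_, Metric.tendsto_nhds.2 fun ε hε => ?_⟩
  · obtain ⟨z, -, hz⟩ := hN n hn
    exact (hs n ⟨z, hz⟩).1
  · filter_upwards [hev (ε / 2) (half_pos hε)] with n ⟨z, hzq, hz⟩
    rw [dist_comm, ← (hs n ⟨z, hz⟩).2]
    calc infDist q (S n) ≤ dist q z := infDist_le_dist_of_mem hz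
      _ ≤ ε / 2 := by rwa [dist_comm]
      _ < ε := half_lt_self hε
end

section
/- Let M̂(P) denote the minimum of |z| over the complex roots z of a nonconstant polynomial P. Then: lim_{r→∞} M̂(x^{r+1} − 2x^r + x − 1) = 1; lim_{r→∞} M̂(x^{r+1} − x^r − x^{r−1} − ⋯ − x − 1) = 1; and, with χ(x) = x⁴ − x³ − 2x² + 1, for each choice of sign ±, lim_{n→∞} M̂(χ(x)·xⁿ ± (x³ + x² − x − 1)) = 1 and lim_{n→∞} M̂(χ(x)·xⁿ ± (x⁴ − x² + 1)) = 1. -/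
open Polynomial

/-- The minimal absolute value of the complex roots of a polynomial `P`. -/
noncomputable def minRootAbs (P : Polynomial ℂ) : ℝ :=
  sInf ((fun z : ℂ => ‖z‖) '' {z : ℂ | P.eval z = 0})

open Filter Topology

/-- A nonconstant monic polynomial whose constant term has norm `1` has a root in the closed
unit disc. -/
theorem exists_root_norm_le_one {P : ℂ[X]} (hP : P.Monic) (hd : 0 < P.natDegree)
    (h0 : ‖P.eval 0‖ = 1) : ∃ z, P.eval z = 0 ∧ ‖z‖ ≤ 1 := by
  by_contra! hroots
  have hs := IsAlgClosed.splits P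
  have hprod : ‖P.roots.prod‖ = 1 := by
    rw [← h0, ← coeff_zero_eq_eval_zero, hs.coeff_zero_eq_prod_roots_of_monic hP]
    simp
  have hone_lt : ∀ s : Multiset ℂ, (∀ z ∈ s, 1 < ‖z‖) → s = 0 ∨ 1 < ‖s.prod‖ := by
    intro s
    induction s using Multiset.induction_on with
    | empty => simp
    | cons a s ih =>
      intro h
      right
      have ha : 1 < ‖a‖ := h a (Multiset.mem_cons_self a s)
      rcases ih fun z hz => h z (Multiset.mem_cons_of_mem hz) with rfl | hs
      · simpa using ha
      · rw [Multiset.prod_cons, norm_mul]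
        exact one_lt_mul_of_lt_of_le ha hs.le
  rcases hone_lt P.roots fun z hz => hroots z (isRoot_of_mem_roots hz) with h | h
  · have := hs.natDegree_eq_card_roots
    simp [h] at this
    omega
  · exact h.ne' hprod

theorem minRootAbs_le {P : ℂ[X]} {z : ℂ} (hz : P.eval z = 0) : minRootAbs P ≤ ‖z‖ :=
  csInf_le ⟨0, by rintro _ ⟨w, -, rfl⟩; exact norm_nonneg w⟩ ⟨z, hz, rfl⟩

/-- If the perturbing polynomial `B` has no zero in the open unit disc, then for `ρ < 1` the
zeros of `A zⁿ + B` have norm larger than `ρ` for all large `n`. -/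
theorem eventually_lt_norm_of_root (A : ℂ[X]) {B : ℂ[X]} (hB : ∀ z, ‖z‖ < 1 → B.eval z ≠ 0)
    {ρ : ℝ} (hρ0 : 0 ≤ ρ) (hρ : ρ < 1) :
    ∀ᶠ n : ℕ in atTop, ∀ z, A.eval z * z ^ n + B.eval z = 0 → ρ < ‖z‖ := by
  have hK : IsCompact (Metric.closedBall (0 : ℂ) ρ) := isCompact_closedBall 0 ρ
  obtain ⟨M, hM⟩ := hK.exists_bound_of_continuousOn A.continuous.continuousOn
  obtain ⟨w, hw, hmin⟩ := hK.exists_isMinOn ⟨0, by simpa using hρ0⟩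
    B.continuous.norm.continuousOn
  have hc : 0 < ‖B.eval w‖ :=
    norm_pos_iff.mpr (hB w ((mem_closedBall_zero_iff.mp hw).trans_lt hρ))
  have hlim : Tendsto (fun n : ℕ => M * ρ ^ n) atTop (𝓝 0) := by
    simpa using (tendsto_pow_atTop_nhds_zero_of_lt_one hρ0 hρ).const_mul M
  filter_upwards [hlim.eventually_lt_const hc] with n hn z hz
  by_contra! hzρ
  have hzK : z ∈ Metric.closedBall (0 : ℂ) ρ := mem_closedBall_zero_iff.mpr hzρ
  have hAM := hM z hzK
  have hBz : ‖B.eval w‖ ≤ ‖B.eval z‖ := hmin hzK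
  have heq : ‖B.eval z‖ = ‖A.eval z‖ * ‖z‖ ^ n := by
    rw [← norm_pow, ← norm_mul, eq_neg_of_add_eq_zero_left hz, norm_neg]
  have hle : ‖A.eval z‖ * ‖z‖ ^ n ≤ M * ρ ^ n :=
    mul_le_mul hAM (pow_le_pow_left₀ (norm_nonneg z) hzρ n) (by positivity)
      ((norm_nonneg _).trans hAM)
  linarith

theorem tendsto_minRootAbs {P : ℕ → ℂ[X]} (A : ℂ[X]) {B : ℂ[X]}
    (hP : ∀ᶠ n in atTop, (P n).Monic ∧ 0 < (P n).natDegree ∧ ‖(P n).eval 0‖ = 1)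
    (hroot : ∀ n z, (P n).eval z = 0 → A.eval z * z ^ n + B.eval z = 0)
    (hB : ∀ z, ‖z‖ < 1 → B.eval z ≠ 0) :
    Tendsto (fun n => minRootAbs (P n)) atTop (𝓝 1) := by
  have hex : ∀ᶠ n in atTop, ∃ z, (P n).eval z = 0 ∧ ‖z‖ ≤ 1 :=
    hP.mono fun n h => exists_root_norm_le_one h.1 h.2.1 h.2.2
  rw [tendsto_order]
  refine ⟨fun a ha => ?_, fun a ha => ?_⟩
  · obtain ⟨ρ, hρ, hρ1⟩ := exists_between (max_lt ha zero_lt_one)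
    filter_upwards [hex, eventually_lt_norm_of_root A hB
      ((le_max_right a 0).trans hρ.le) hρ1] with n ⟨z, hz, _⟩ hn
    refine ((le_max_left a 0).trans_lt hρ).trans_le (le_csInf ⟨_, z, hz, rfl⟩ ?_)
    rintro _ ⟨w, hw, rfl⟩
    exact (hn w (hroot n w hw)).le
  · filter_upwards [hex] with n ⟨z, hz, hz1⟩
    exact ((minRootAbs_le hz).trans hz1).trans_lt ha

theorem tendsto_minRootAbs_mul_X_pow_add {A B : ℂ[X]} (hA : A.Monic)
    (hBA : B.natDegree ≤ A.natDegree) (hB0 : ‖B.eval 0‖ = 1)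
    (hB : ∀ z, ‖z‖ < 1 → B.eval z ≠ 0) :
    Tendsto (fun n : ℕ => minRootAbs (A * X ^ n + B)) atTop (𝓝 1) := by
  refine tendsto_minRootAbs A ?_ (fun n z hz => by simpa using hz) hB
  filter_upwards [eventually_gt_atTop 0] with n hn
  have hnat : (A * X ^ n).natDegree = A.natDegree + n := by
    rw [hA.natDegree_mul (monic_X_pow n), natDegree_X_pow]
  have hlt : B.natDegree < (A * X ^ n).natDegree := by omega
  refine ⟨(hA.mul (monic_X_pow n)).add_of_left (degree_lt_degree hlt), ?_, ?_⟩
  · rw [natDegree_add_eq_left_of_natDegree_lt hlt]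
    omega
  · simpa [hn.ne'] using hB0

theorem tendsto_minRootAbs_multinacci :
    Tendsto (fun r : ℕ => minRootAbs (X ^ (r + 1) - ∑ i ∈ Finset.range (r + 1), X ^ i))
      atTop (𝓝 1) := by
  refine tendsto_minRootAbs (X ^ 2 - 2 * X) (B := 1) (Eventually.of_forall fun r => ?_)
    (fun r z hz => ?_) (by simp)
  · have hdeg : (∑ i ∈ Finset.range (r + 1), X ^ i : ℂ[X]).degree < (r + 1 : ℕ) := by
      refine (degree_sum_le _ _).trans_lt ((Finset.sup_lt_iff (WithBot.bot_lt_coe _)).mpr ?_)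
      intro i hi
      rw [degree_X_pow]
      exact_mod_cast Finset.mem_range.mp hi
    refine ⟨(monic_X_pow _).sub_of_left (by rwa [degree_X_pow]), ?_, ?_⟩
    · rw [natDegree_pos_iff_degree_pos, degree_sub_eq_left_of_degree_lt (by rwa [degree_X_pow]),
        degree_X_pow]
      exact_mod_cast r.succ_pos
    · simp [eval_finsetSum, Finset.sum_range_succ']
  · have hgeom := geom_sum_mul z (r + 1)
    simp only [eval_sub, eval_pow, eval_X, eval_finsetSum] at hz
    simp only [eval_sub, eval_pow, eval_X, eval_mul, eval_ofNat, eval_one]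
    linear_combination (z - 1) * hz + hgeom

theorem stmt_13 :
    Filter.Tendsto (fun r : ℕ => minRootAbs (X ^ (r + 1) - 2 * X ^ r + X - 1))
      Filter.atTop (nhds 1) ∧
    Filter.Tendsto
      (fun r : ℕ => minRootAbs (X ^ (r + 1) - ∑ i ∈ Finset.range (r + 1), X ^ i))
      Filter.atTop (nhds 1) ∧
    ∀ ε : ℂ, (ε = 1 ∨ ε = -1) →
      Filter.Tendsto
        (fun n : ℕ => minRootAbs
          ((X ^ 4 - X ^ 3 - 2 * X ^ 2 + 1) * X ^ n + C ε * (X ^ 3 + X ^ 2 - X - 1)))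
        Filter.atTop (nhds 1) ∧
      Filter.Tendsto
        (fun n : ℕ => minRootAbs
          ((X ^ 4 - X ^ 3 - 2 * X ^ 2 + 1) * X ^ n + C ε * (X ^ 4 - X ^ 2 + 1)))
        Filter.atTop (nhds 1) := by
  refine ⟨?_, tendsto_minRootAbs_multinacci, fun ε hε => ⟨?_, ?_⟩⟩
  · have h := tendsto_minRootAbs_mul_X_pow_add (A := X - C 2) (B := X - C 1)
      (monic_X_sub_C _) (by rw [natDegree_X_sub_C, natDegree_X_sub_C]) (by simp)
      (fun z hz h => by
        have : z = 1 := by simpa [sub_eq_zero] using h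
        simp [this] at hz)
    refine h.congr fun n => ?_
    congr 1
    simp only [map_one, map_ofNat]
    ring
  · have hε0 : ε ≠ 0 := by rcases hε with rfl | rfl <;> simp
    have hd : (X ^ 4 - X ^ 3 - 2 * X ^ 2 + 1 : ℂ[X]).natDegree = 4 := by compute_degree!
    refine tendsto_minRootAbs_mul_X_pow_add (by monicity!) ?_ ?_ ?_
    · rw [hd]
      compute_degree!
    · rcases hε with rfl | rfl <;> simp
    · intro z hz h
      have h' : (z + 1) * (z + 1) * (z - 1) = 0 := by
        have : z ^ 3 + z ^ 2 - z - 1 = 0 := by simpa [hε0] using h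
        linear_combination this
      simp only [mul_eq_zero, or_self] at h'
      rcases h' with h' | h'
      · rw [eq_neg_of_add_eq_zero_left h'] at hz
        simp at hz
      · rw [sub_eq_zero.mp h'] at hz
        simp at hz
  · have hε0 : ε ≠ 0 := by rcases hε with rfl | rfl <;> simp
    have hd : (X ^ 4 - X ^ 3 - 2 * X ^ 2 + 1 : ℂ[X]).natDegree = 4 := by compute_degree!
    refine tendsto_minRootAbs_mul_X_pow_add (by monicity!) ?_ ?_ ?_
    · rw [hd]
      compute_degree
    · rcases hε with rfl | rfl <;> simp
    · intro z hz h
      have h' : z ^ 6 = -1 := by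
        have : z ^ 4 - z ^ 2 + 1 = 0 := by simpa [hε0] using h
        linear_combination (z ^ 2 + 1) * this
      have h1 : ‖z‖ ^ 6 = 1 := by rw [← norm_pow, h']; simp
      exact (pow_lt_one₀ (norm_nonneg z) hz (by norm_num)).ne h1
end

section
/- For n ∈ ℕ let C_n be the convex hull (in ℂ, identified with ℝ²) of the set {q' ∈ ℂ : |q'| < 1 and (q'² − q' − 1)·q'ⁿ + 1 = 0} of roots of modulus less than 1 of the polynomial (x² − x − 1)·xⁿ + 1. Then for every ε ∈ (0,1) there exists N ∈ ℕ such that for all n > N, {z ∈ ℂ : |z| ≤ 1 − ε} ⊆ C_n ⊆ {z ∈ ℂ : |z| ≤ 1}. -/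
open Filter Topology

theorem map_nhds_mul_exp_mul_log (ζ : ℂ) (hζ : 1 + ζ - ζ ^ 2 ∈ Complex.slitPlane) :
    map (fun p : ℂ × ℂ => (p.1, p.2 * Complex.exp (p.1 * Complex.log (1 + p.2 - p.2 ^ 2))))
      (𝓝 (0, ζ)) = 𝓝 (0, ζ) := by
  have hfst : HasStrictFDerivAt (fun p : ℂ × ℂ => p.1) (ContinuousLinearMap.fst ℂ ℂ ℂ) (0, ζ) :=
    hasStrictFDerivAt_fst
  have hsnd : HasStrictFDerivAt (fun p : ℂ × ℂ => p.2) (ContinuousLinearMap.snd ℂ ℂ ℂ) (0, ζ) :=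
    hasStrictFDerivAt_snd
  have hlog := (((hsnd.const_add 1).sub (hsnd.pow 2)).clog hζ)
  have hG := hfst.prodMk (hsnd.mul (hfst.mul hlog).cexp)
  have hmap := hG.map_nhds_eq_of_surj (LinearMap.range_eq_top.mpr ?_)
  · simpa using hmap
  · rintro ⟨a, b⟩
    refine ⟨(a, b - ζ * (Complex.log (1 + ζ - ζ ^ 2) * a)), ?_⟩
    simp

theorem one_add_sub_sq_mem_slitPlane {ζ : ℂ} (h1 : ‖ζ‖ = 1) (him : ζ.im ≠ 0) :
    1 + ζ - ζ ^ 2 ∈ Complex.slitPlane := by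
  have hsq : ζ.re * ζ.re + ζ.im * ζ.im = 1 := by
    rw [← Complex.normSq_apply, Complex.normSq_eq_norm_sq, h1, one_pow]
  rw [Complex.mem_slitPlane_iff]
  by_cases h : ζ.re = 1 / 2
  · left
    simp only [Complex.sub_re, Complex.add_re, Complex.one_re, pow_two, Complex.mul_re]
    nlinarith
  · right
    have : (1 + ζ - ζ ^ 2).im = ζ.im * (1 - 2 * ζ.re) := by
      simp only [Complex.sub_im, Complex.add_im, Complex.one_im, pow_two, Complex.mul_im]
      ring
    rw [this]
    exact mul_ne_zero him fun h' => h (by linarith)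

theorem one_lt_norm_one_add_sub_sq {ζ : ℂ} (h1 : ‖ζ‖ = 1) (him : ζ.im ≠ 0) :
    1 < ‖1 + ζ - ζ ^ 2‖ := by
  have hsq : ζ.re ^ 2 + ζ.im ^ 2 = 1 := by
    rw [pow_two, pow_two, ← Complex.normSq_apply, Complex.normSq_eq_norm_sq, h1, one_pow]
  have hnorm : ‖1 + ζ - ζ ^ 2‖ ^ 2 = 1 + 4 * ζ.im ^ 2 := by
    rw [← Complex.normSq_eq_norm_sq, Complex.normSq_apply]
    simp only [Complex.sub_re, Complex.add_re, Complex.one_re, pow_two, Complex.mul_re,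
      Complex.sub_im, Complex.add_im, Complex.one_im, Complex.mul_im]
    linear_combination (ζ.re ^ 2 + ζ.im ^ 2 - 2 * ζ.re) * hsq
  have := sq_pos_of_ne_zero him
  nlinarith [norm_nonneg (1 + ζ - ζ ^ 2)]

/-- Every point of the unit circle is a limit of `n`-th roots of unity. -/
theorem exists_tendsto_pow_eq_one {ζ : ℂ} (h1 : ‖ζ‖ = 1) :
    ∃ ω : ℕ → ℂ, Tendsto ω atTop (𝓝 ζ) ∧ ∀ n, n ≠ 0 → ω n ^ n = 1 := by
  obtain ⟨x, hx0, hζ⟩ : ∃ x : ℝ, 0 ≤ x ∧ Complex.exp (2 * Real.pi * Complex.I * (x : ℂ)) = ζ := by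
    refine ⟨ζ.arg / (2 * Real.pi) + 1, ?_, ?_⟩
    · have hπ := Real.pi_pos
      rw [div_add_one (by positivity)]
      exact div_nonneg (by linarith [Complex.neg_pi_lt_arg ζ]) (by positivity)
    · have h := Complex.norm_mul_exp_arg_mul_I ζ
      rw [h1, Complex.ofReal_one, one_mul] at h
      refine Eq.trans ?_ ((Complex.exp_periodic _).trans h)
      congr 1
      have := Complex.ofReal_ne_zero.mpr Real.pi_ne_zero
      push_cast
      field_simp
  have hlim : Tendsto (fun n : ℕ => ((⌊x * n⌋₊ : ℝ) / n)) atTop (𝓝 x) :=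
    (tendsto_nat_floor_mul_div_atTop hx0).comp tendsto_natCast_atTop_atTop
  refine ⟨fun n => Complex.exp (2 * Real.pi * Complex.I * (((⌊x * n⌋₊ : ℝ) / n : ℝ) : ℂ)), ?_, ?_⟩
  · rw [← hζ]
    exact (Complex.continuous_exp.tendsto _).comp
      (((Complex.continuous_ofReal.tendsto _).comp hlim).const_mul _)
  · intro n hn
    rw [← Complex.exp_nat_mul, Complex.exp_eq_one_iff]
    refine ⟨⌊x * n⌋₊, ?_⟩
    have : (n : ℂ) ≠ 0 := by exact_mod_cast hn
    push_cast
    field_simp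

theorem eventually_exists_root_near {ζ : ℂ} (h1 : ‖ζ‖ = 1) (him : ζ.im ≠ 0) {δ : ℝ}
    (hδ : 0 < δ) :
    ∀ᶠ n : ℕ in atTop, ∃ z : ℂ, (‖z‖ < 1 ∧ (z ^ 2 - z - 1) * z ^ n + 1 = 0) ∧ dist z ζ < δ := by
  obtain ⟨ω, hω, hpow⟩ := exists_tendsto_pow_eq_one h1
  have hcont : Continuous fun p : ℂ × ℂ => 1 + p.2 - p.2 ^ 2 := by fun_prop
  have hV : ∀ᶠ p : ℂ × ℂ in 𝓝 (0, ζ), 1 < ‖1 + p.2 - p.2 ^ 2‖ ∧ dist p.2 ζ < δ :=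
    (hcont.norm.continuousAt.eventually
      (lt_mem_nhds (one_lt_norm_one_add_sub_sq h1 him))).and
      (continuous_snd.tendsto (0, ζ) (Metric.ball_mem_nhds ζ hδ))
  have himage := image_mem_map (m := fun p : ℂ × ℂ =>
    (p.1, p.2 * Complex.exp (p.1 * Complex.log (1 + p.2 - p.2 ^ 2)))) hV
  rw [map_nhds_mul_exp_mul_log ζ (one_add_sub_sq_mem_slitPlane h1 him)] at himage
  have hlim : Tendsto (fun n : ℕ => ((n : ℂ)⁻¹, ω n)) atTop (𝓝 (0, ζ)) :=
    tendsto_inv_atTop_nhds_zero_nat.prodMk_nhds hω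
  filter_upwards [hlim himage, eventually_ne_atTop 0] with n hn hn0
  obtain ⟨⟨t, z⟩, ⟨hnorm, hdist⟩, heq⟩ := hn
  simp only [Prod.mk.injEq] at heq hnorm hdist
  obtain ⟨rfl, heq⟩ := heq
  have hne : 1 + z - z ^ 2 ≠ 0 := norm_pos_iff.mp (one_pos.trans hnorm)
  have hroot : z ^ n * (1 + z - z ^ 2) = 1 := by
    have h := hpow n hn0
    rwa [← heq, mul_pow, ← Complex.exp_nat_mul, ← mul_assoc,
      mul_inv_cancel₀ (Nat.cast_ne_zero.mpr hn0), one_mul, Complex.exp_log hne] at h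
  refine ⟨z, ⟨?_, by linear_combination -hroot⟩, hdist⟩
  by_contra! hz
  have hprod := congrArg norm hroot
  rw [norm_mul, norm_pow, norm_one] at hprod
  nlinarith [one_le_pow₀ hz (n := n)]

theorem exists_im_ne_zero_dist_lt {u : ℂ} (h1 : ‖u‖ = 1) {δ : ℝ} (hδ : 0 < δ) :
    ∃ ζ : ℂ, (‖ζ‖ = 1 ∧ ζ.im ≠ 0) ∧ dist u ζ < δ := by
  by_cases him : u.im = 0
  · obtain ⟨r, hr0, hr⟩ := exists_between (lt_min hδ Real.pi_pos)
    rw [lt_min_iff] at hr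
    have hre : u.re ≠ 0 := fun h => by
      rw [Complex.ext (z := u) (w := 0) h him] at h1
      simp at h1
    refine ⟨u * Complex.exp (Complex.I * r), ⟨?_, ?_⟩, ?_⟩
    · rw [norm_mul, h1, Complex.norm_exp_I_mul_ofReal, one_mul]
    · rw [Complex.mul_im, him, mul_comm Complex.I, Complex.exp_ofReal_mul_I_im, zero_mul, add_zero]
      exact mul_ne_zero hre (Real.sin_pos_of_pos_of_lt_pi hr0 hr.2).ne'
    · rw [dist_comm, dist_eq_norm, ← mul_sub_one, norm_mul, h1, one_mul]
      refine (Real.norm_exp_I_mul_ofReal_sub_one_le).trans_lt ?_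
      rw [Real.norm_of_nonneg hr0.le]
      exact hr.1
  · exact ⟨u, ⟨h1, him⟩, by simpa using hδ⟩

theorem eventually_forall_exists_root_near {ε : ℝ} (hε : 0 < ε) :
    ∀ᶠ n : ℕ in atTop, ∀ u : ℂ, ‖u‖ = 1 →
      ∃ z : ℂ, (‖z‖ < 1 ∧ (z ^ 2 - z - 1) * z ^ n + 1 = 0) ∧ dist z u < ε := by
  have htb : TotallyBounded {ζ : ℂ | ‖ζ‖ = 1 ∧ ζ.im ≠ 0} :=
    (isCompact_sphere (0 : ℂ) 1).totallyBounded.subset fun ζ hζ => by simpa using hζ.1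
  obtain ⟨t, hts, htf, hcover⟩ :=
    Metric.finite_approx_of_totallyBounded htb (ε / 3) (by positivity)
  have hroots := (eventually_all_finite htf).mpr fun ζ hζ =>
    eventually_exists_root_near (hts hζ).1 (hts hζ).2 (δ := ε / 3) (by positivity)
  filter_upwards [hroots] with n hn u hu
  obtain ⟨ζ, hζ, huζ⟩ := exists_im_ne_zero_dist_lt hu (δ := ε / 3) (by positivity)
  obtain ⟨y, hy, hζy⟩ := Set.mem_iUnion₂.mp (hcover hζ)
  obtain ⟨z, hz, hzy⟩ := hn y hy
  rw [Metric.mem_ball] at hζy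
  refine ⟨z, hz, ?_⟩
  have h := dist_triangle4 z y ζ u
  rw [dist_comm y ζ, dist_comm ζ u] at h
  linarith

theorem finite_setOf_root {n : ℕ} (hn : n ≠ 0) :
    {z : ℂ | ‖z‖ < 1 ∧ (z ^ 2 - z - 1) * z ^ n + 1 = 0}.Finite := by
  open Polynomial in
  have hp : ((X ^ 2 - X - 1) * X ^ n + 1 : ℂ[X]) ≠ 0 := fun h => by
    simpa [hn] using congrArg (eval 0) h
  refine (Polynomial.finite_setOfPred_isRoot hp).subset fun z hz => ?_
  simpa [Polynomial.IsRoot] using hz.2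

/-- A nonempty closed convex subset of a Hilbert space that comes `ε`-close to every unit vector contains
the closed ball of radius `1 - ε`. -/
theorem mem_of_forall_exists_dist_lt {E : Type*} [NormedAddCommGroup E] [InnerProductSpace ℝ E]
    [CompleteSpace E] {s : Set E} (hconv : Convex ℝ s) (hclosed : IsClosed s) (hne : s.Nonempty)
    {ε : ℝ} (hs : ∀ u : E, ‖u‖ = 1 → ∃ w ∈ s, dist w u < ε) {x : E} (hx : ‖x‖ ≤ 1 - ε) :
    x ∈ s := by
  by_contra hxs
  obtain ⟨f, c, hf, hc⟩ := geometric_hahn_banach_closed_point hconv hclosed hxs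
  set v : E := (InnerProductSpace.toDual ℝ E).symm f
  have hfv : ∀ a, f a = inner ℝ v a := fun a =>
    (InnerProductSpace.toDual_symm_apply).symm
  have hv : v ≠ 0 := fun h => by
    obtain ⟨w, hw⟩ := hne
    have := hf w hw
    rw [hfv, h, inner_zero_left] at this hc
    linarith
  have hv0 : 0 < ‖v‖ := norm_pos_iff.mpr hv
  obtain ⟨w, hw, hdist⟩ := hs (‖v‖⁻¹ • v) (norm_smul_inv_norm hv)
  have hfw := hf w hw
  rw [hfv] at hfw hc
  have hinner : inner ℝ v (‖v‖⁻¹ • v) = ‖v‖ := by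
    rw [real_inner_smul_right, real_inner_self_eq_norm_sq]
    field_simp
  have hsub := real_inner_le_norm v (‖v‖⁻¹ • v - w)
  rw [inner_sub_right, hinner, ← dist_eq_norm, dist_comm] at hsub
  have hvx := real_inner_le_norm v x
  nlinarith [mul_lt_mul_of_pos_left hdist hv0, mul_le_mul_of_nonneg_left hx hv0.le]

theorem stmt_16 (ε : ℝ) (hε0 : 0 < ε) (hε1 : ε < 1) :
    ∃ N : ℕ, ∀ n : ℕ, N < n →
      {z : ℂ | ‖z‖ ≤ 1 - ε} ⊆
          convexHull ℝ {z : ℂ | ‖z‖ < 1 ∧ (z ^ 2 - z - 1) * z ^ n + 1 = 0} ∧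
        convexHull ℝ {z : ℂ | ‖z‖ < 1 ∧ (z ^ 2 - z - 1) * z ^ n + 1 = 0} ⊆
          {z : ℂ | ‖z‖ ≤ 1} := by
  obtain ⟨N, hN⟩ := eventually_atTop.mp (eventually_forall_exists_root_near hε0)
  refine ⟨N, fun n hn => ⟨fun x hx => ?_, convexHull_min (fun z hz => hz.1.le) ?_⟩⟩
  · have hnear := hN n hn.le
    obtain ⟨w, hw, -⟩ := hnear 1 norm_one
    refine mem_of_forall_exists_dist_lt (convex_convexHull ℝ _)
      ((finite_setOf_root (Nat.ne_zero_of_lt hn)).isClosed_convexHull ℝ) ⟨w, subset_convexHull ℝ _ hw⟩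
      (fun u hu => ?_) hx
    obtain ⟨z, hz, hzu⟩ := hnear u hu
    exact ⟨z, subset_convexHull ℝ _ hz, hzu⟩
  · simpa [Metric.closedBall, dist_zero_right] using convex_closedBall (0 : ℂ) 1
end

section
/- The set of limit points of the Galois conjugates of Pisot numbers contains the unit circle: for every w ∈ ℂ with |w| = 1 and every ε > 0, there exist a Pisot number q and a Galois conjugate q' of q such that |q' − w| < ε. -/
open Polynomial in
/-- If `z` is a nonzero algebraic integer, some root of its minimal polynomial lies outside the
open unit disc. -/
lemma exists_one_le_norm_of_isIntegral {z : ℂ} (hz : IsIntegral ℤ z) (hz0 : z ≠ 0) :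
    ∃ y : ℂ, aeval y (minpoly ℚ z) = 0 ∧ 1 ≤ ‖y‖ := by
  by_contra! h
  have hprod : ∀ s : Multiset ℂ, (∀ y ∈ s, ‖y‖ < 1) → s ≠ 0 → ‖s.prod‖ < 1 := by
    intro s
    induction s using Multiset.induction_on with
    | empty => simp
    | cons a s ih =>
      intro hs _
      rw [Multiset.prod_cons, norm_mul]
      have ha := hs a (Multiset.mem_cons_self a s)
      rcases eq_or_ne s 0 with rfl | hs0
      · simpa using ha
      · have := ih (fun y hy => hs y (Multiset.mem_cons_of_mem hy)) hs0
        exact mul_lt_one_of_nonneg_of_lt_one_left (norm_nonneg _) ha this.le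
  have hzQ : IsIntegral ℚ z := hz.tower_top
  have hmap : minpoly ℚ z = (minpoly ℤ z).map (algebraMap ℤ ℚ) :=
    minpoly.isIntegrallyClosed_eq_field_fractions' ℚ hz
  have hmonic : ((minpoly ℚ z).map (algebraMap ℚ ℂ)).Monic := (minpoly.monic hzQ).map _
  have hroots : ∀ y ∈ ((minpoly ℚ z).map (algebraMap ℚ ℂ)).roots, ‖y‖ < 1 := by
    intro y hy
    apply h
    rw [mem_roots hmonic.ne_zero, IsRoot.def, eval_map_algebraMap] at hy
    exact hy
  have hne : ((minpoly ℚ z).map (algebraMap ℚ ℂ)).roots ≠ 0 := by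
    intro hempty
    refine Multiset.notMem_zero z (hempty ▸ ?_)
    rw [mem_roots hmonic.ne_zero, IsRoot.def, eval_map_algebraMap]
    exact minpoly.aeval ℚ z
  have hlt := hprod _ hroots hne
  have hcoeff := (IsAlgClosed.splits ((minpoly ℚ z).map (algebraMap ℚ ℂ)))
    |>.coeff_zero_eq_prod_roots_of_monic hmonic
  have hnorm : ‖((minpoly ℚ z).map (algebraMap ℚ ℂ)).coeff 0‖ < 1 := by
    rw [hcoeff]
    simpa using hlt
  rw [coeff_map, hmap, coeff_map] at hnorm
  have hint : |(minpoly ℤ z).coeff 0| < 1 := by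
    have : ‖(((minpoly ℤ z).coeff 0 : ℤ) : ℂ)‖ < 1 := by simpa using hnorm
    rw [Complex.norm_intCast] at this
    exact_mod_cast this
  refine minpoly.coeff_zero_ne_zero hzQ hz0 ?_
  rw [hmap, coeff_map, Int.abs_lt_one_iff.mp hint, map_zero]

/-- A root of `X ^ n * (3 - X) - 1` outside the open unit disc has norm at least `2`. -/
lemma two_le_norm_of_pow_mul_three_sub_eq_one {n : ℕ} {x : ℂ} (hx : x ^ n * (3 - x) = 1)
    (h1 : 1 ≤ ‖x‖) : 2 ≤ ‖x‖ := by
  have h := congrArg norm hx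
  rw [norm_mul, norm_pow, norm_one] at h
  have hp : 1 ≤ ‖x‖ ^ n := one_le_pow₀ h1
  have h3 : ‖3 - x‖ ≤ 1 := by nlinarith [norm_nonneg (3 - x)]
  have := norm_sub_norm_le (3 : ℂ) x
  norm_num at this
  linarith

/-- `X ^ n * (3 - X) - 1` has at most one root outside the open unit disc. -/
lemma eq_of_pow_mul_three_sub_eq_one {n : ℕ} {x y : ℂ} (hx : x ^ n * (3 - x) = 1)
    (hy : y ^ n * (3 - y) = 1) (hx1 : 1 ≤ ‖x‖) (hy1 : 1 ≤ ‖y‖) : x = y := by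
  have hx2 := two_le_norm_of_pow_mul_three_sub_eq_one hx hx1
  have hy2 := two_le_norm_of_pow_mul_three_sub_eq_one hy hy1
  have hx0 : x ≠ 0 := norm_pos_iff.mp (by linarith)
  have hy0 : y ≠ 0 := norm_pos_iff.mp (by linarith)
  have hs : ‖x⁻¹‖ ≤ 1 / 2 := by
    rw [norm_inv, one_div]; exact inv_anti₀ (by norm_num) hx2
  have ht : ‖y⁻¹‖ ≤ 1 / 2 := by
    rw [norm_inv, one_div]; exact inv_anti₀ (by norm_num) hy2
  have hpow : ∀ m : ℕ, ‖x⁻¹ ^ m - y⁻¹ ^ m‖ ≤ 2 * ‖x⁻¹ - y⁻¹‖ := by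
    intro m
    induction m with
    | zero => simp
    | succ m ih =>
      have hsplit : x⁻¹ ^ (m + 1) - y⁻¹ ^ (m + 1)
          = x⁻¹ * (x⁻¹ ^ m - y⁻¹ ^ m) + y⁻¹ ^ m * (x⁻¹ - y⁻¹) := by ring
      have hle : ‖y⁻¹ ^ m‖ ≤ 1 := by
        rw [norm_pow]; exact pow_le_one₀ (norm_nonneg _) (by linarith)
      calc ‖x⁻¹ ^ (m + 1) - y⁻¹ ^ (m + 1)‖
          ≤ ‖x⁻¹‖ * ‖x⁻¹ ^ m - y⁻¹ ^ m‖ + ‖y⁻¹ ^ m‖ * ‖x⁻¹ - y⁻¹‖ := by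
            rw [hsplit, ← norm_mul, ← norm_mul]; exact norm_add_le _ _
        _ ≤ 1 / 2 * (2 * ‖x⁻¹ - y⁻¹‖) + 1 * ‖x⁻¹ - y⁻¹‖ := by gcongr
        _ = 2 * ‖x⁻¹ - y⁻¹‖ := by ring
  have hxe : x⁻¹ ^ n = 3 - x := by
    rw [inv_pow]; exact inv_eq_of_mul_eq_one_right hx
  have hye : y⁻¹ ^ n = 3 - y := by
    rw [inv_pow]; exact inv_eq_of_mul_eq_one_right hy
  have hdiff : x⁻¹ - y⁻¹ = x⁻¹ * y⁻¹ * (x⁻¹ ^ n - y⁻¹ ^ n) := by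
    rw [hxe, hye]; field_simp; ring
  have hle : ‖x⁻¹ - y⁻¹‖ ≤ 1 / 2 * (1 / 2) * (2 * ‖x⁻¹ - y⁻¹‖) := by
    calc ‖x⁻¹ - y⁻¹‖ = ‖x⁻¹‖ * ‖y⁻¹‖ * ‖x⁻¹ ^ n - y⁻¹ ^ n‖ := by
          rw [← norm_mul, ← norm_mul, ← hdiff]
      _ ≤ _ := by gcongr; exact hpow n
  have hzero : ‖x⁻¹ - y⁻¹‖ = 0 := le_antisymm (by linarith) (norm_nonneg _)
  exact inv_injective (sub_eq_zero.mp (norm_eq_zero.mp hzero))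

open Polynomial in
/-- The conjugates of a root of `X ^ n * (3 - X) - 1` are again roots of it. -/
lemma pow_mul_three_sub_eq_one_of_aeval_minpoly {n : ℕ} {x y : ℂ} (hx : x ^ n * (3 - x) = 1)
    (hy : aeval y (minpoly ℚ x) = 0) : y ^ n * (3 - y) = 1 := by
  have hdvd : minpoly ℚ x ∣ (X ^ n * (3 - X) - 1 : ℚ[X]) := by
    apply minpoly.dvd
    simp [hx, map_ofNat (aeval x) 3]
  obtain ⟨r, hr⟩ := hdvd
  have h := congrArg (aeval y) hr
  rw [map_mul, hy, zero_mul] at h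
  simpa [sub_eq_zero, map_ofNat (aeval y) 3] using h

open Polynomial in
lemma isIntegral_of_pow_mul_three_sub_eq_one {n : ℕ} {x : ℂ} (hx : x ^ n * (3 - x) = 1) :
    IsIntegral ℤ x := by
  refine ⟨X ^ (n + 1) + (-3 * X ^ n + 1), ?_, ?_⟩
  · apply monic_X_pow_add
    compute_degree!
    exact WithBot.coe_lt_coe.mpr (Nat.cast_lt.mpr n.lt_succ_self)
  · simp only [eval₂_add, eval₂_mul, eval₂_pow, eval₂_X, eval₂_neg, eval₂_one, eval₂_ofNat]
    linear_combination -hx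

lemma exists_real_pow_mul_three_sub_eq_one (n : ℕ) :
    ∃ q : ℝ, 1 < q ∧ q ^ n * (3 - q) = 1 := by
  have hcont : ContinuousOn (fun q : ℝ => q ^ n * (3 - q)) (Set.Icc 1 3) := by fun_prop
  obtain ⟨q, hq, hq1⟩ := intermediate_value_Ioo' (by norm_num) hcont
    (show (1 : ℝ) ∈ Set.Ioo _ _ by norm_num)
  exact ⟨q, hq.1, hq1⟩

/-- Every root of `X ^ n * (3 - X) - 1` in the closed unit disc is a conjugate of a Pisot number. -/
lemma exists_isPisot_isPisotConj {n : ℕ} {z : ℂ} (hz : z ^ n * (3 - z) = 1) (hz1 : ‖z‖ ≤ 1)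
    (hn : n ≠ 0) : ∃ q : ℝ, IsPisot q ∧ IsPisotConj q z := by
  obtain ⟨q, hq1, hq⟩ := exists_real_pow_mul_three_sub_eq_one n
  have hqC : (q : ℂ) ^ n * (3 - q) = 1 := by exact_mod_cast congrArg Complex.ofReal hq
  have hqnorm : 1 ≤ ‖(q : ℂ)‖ := by
    rw [Complex.norm_real, Real.norm_eq_abs]; exact hq1.le.trans (le_abs_self q)
  have hmin : minpoly ℚ (q : ℂ) = minpoly ℚ q :=
    minpoly.algebraMap_eq (algebraMap ℝ ℂ).injective q
  have hz0 : z ≠ 0 := by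
    rintro rfl
    simp [hn] at hz
  have hzint := isIntegral_of_pow_mul_three_sub_eq_one hz
  refine ⟨q, ⟨hq1, ?_, ?_⟩, ?_, ?_⟩
  · exact (isIntegral_algebraMap_iff (algebraMap ℝ ℂ).injective).mp
      (isIntegral_of_pow_mul_three_sub_eq_one hqC)
  · intro y hy hyq
    rw [← hmin] at hy
    by_contra! hy1
    exact hyq (eq_of_pow_mul_three_sub_eq_one (pow_mul_three_sub_eq_one_of_aeval_minpoly hqC hy)
      hqC hy1 hqnorm)
  · obtain ⟨y, hy, hy1⟩ := exists_one_le_norm_of_isIntegral hzint hz0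
    obtain rfl := eq_of_pow_mul_three_sub_eq_one
      (pow_mul_three_sub_eq_one_of_aeval_minpoly hz hy) hqC hy1 hqnorm
    have hzQ : IsIntegral ℚ z := hzint.tower_top
    rw [← hmin, ← minpoly.eq_of_irreducible_of_monic (minpoly.irreducible hzQ) hy
      (minpoly.monic hzQ)]
    exact minpoly.aeval ℚ z
  · rintro rfl
    have := two_le_norm_of_pow_mul_three_sub_eq_one hz hqnorm
    linarith

lemma two_le_norm_three_sub {x : ℂ} (hx : ‖x‖ ≤ 1) : 2 ≤ ‖3 - x‖ := by
  have := norm_sub_norm_le (3 : ℂ) x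
  norm_num at this
  linarith

/-- For each `c` on the imaginary axis, the equation `z = exp ((c - log (3 - z)) / n)` has a
solution in the closed unit disc. -/
lemma exists_eq_exp_sub_log_div {n : ℕ} (hn : 1 < n) {c : ℂ} (hc : c.re = 0) :
    ∃ z : ℂ, ‖z‖ ≤ 1 ∧ z = Complex.exp ((c - Complex.log (3 - z)) / n) := by
  have hn0 : (0 : ℝ) < n := by positivity
  set f : ℂ → ℂ := fun z => Complex.exp ((c - Complex.log (3 - z)) / n) with hf
  have hfnorm : ∀ x : ℂ, ‖x‖ ≤ 1 → ‖f x‖ ≤ 1 := by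
    intro x hx
    have h2 := two_le_norm_three_sub hx
    rw [hf, Complex.norm_exp, Complex.div_natCast_re, Complex.sub_re, hc, Complex.log_re,
      Real.exp_le_one_iff]
    have := Real.log_nonneg (by linarith : (1 : ℝ) ≤ ‖3 - x‖)
    exact div_nonpos_of_nonpos_of_nonneg (by linarith) hn0.le
  have hmaps : Set.MapsTo f (Metric.closedBall 0 1) (Metric.closedBall 0 1) := by
    intro x hx
    rw [mem_closedBall_zero_iff] at hx ⊢
    exact hfnorm x hx
  have hderiv : ∀ x ∈ Metric.closedBall (0 : ℂ) 1,
      HasDerivWithinAt f (f x * ((3 - x)⁻¹ / n)) (Metric.closedBall 0 1) x := by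
    intro x hx
    rw [mem_closedBall_zero_iff] at hx
    have hslit : 3 - x ∈ Complex.slitPlane := by
      left
      have := (Complex.re_le_norm x).trans hx
      simp only [Complex.sub_re, Complex.re_ofNat]
      linarith
    have h1 : HasDerivAt (fun y : ℂ => 3 - y) (-1) x := by
      simpa using (hasDerivAt_id x).const_sub 3
    have h2 := (((h1.clog hslit).const_sub c).div_const (n : ℂ)).cexp
    have hval : f x * ((3 - x)⁻¹ / n)
        = Complex.exp ((c - Complex.log (3 - x)) / n) * (-(-1 / (3 - x)) / n) := by
      simp only [hf]
      ring
    rw [hval]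
    exact h2.hasDerivWithinAt
  have hlip : LipschitzOnWith (1 / 2) f (Metric.closedBall 0 1) := by
    apply (convex_closedBall (0 : ℂ) 1).lipschitzOnWith_of_nnnorm_hasDerivWithin_le hderiv
    intro x hx
    rw [mem_closedBall_zero_iff] at hx
    rw [← NNReal.coe_le_coe, coe_nnnorm, norm_mul, norm_div, norm_inv, Complex.norm_natCast]
    have h2 := two_le_norm_three_sub hx
    have hi : ‖3 - x‖⁻¹ ≤ 2⁻¹ := inv_anti₀ (by norm_num) h2
    have hn1 : (1 : ℝ) ≤ n := by exact_mod_cast hn.le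
    calc ‖f x‖ * (‖3 - x‖⁻¹ / n) ≤ 1 * (2⁻¹ / 1) := by
          gcongr
          exact hfnorm x hx
      _ = _ := by norm_num
  have hcontr : ContractingWith (1 / 2) (hmaps.restrict f _ _) :=
    ⟨by rw [← NNReal.coe_lt_coe]; norm_num, hlip.mapsToRestrict hmaps⟩
  obtain ⟨z, hz, hfix, -⟩ := hcontr.exists_fixedPoint' Metric.isClosed_closedBall.isComplete hmaps
    (Metric.mem_closedBall_self zero_le_one) (edist_ne_top _ _)
  exact ⟨z, by simpa using hz, hfix.symm⟩

/-- The polynomial `X ^ n * (3 - X) - 1` has a root in the closed unit disc within `O(1 / n)` of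
any given point of the unit circle. -/
lemma exists_root_near {w : ℂ} (hw : ‖w‖ = 1) {n : ℕ} (hn : 16 ≤ n) :
    ∃ z : ℂ, ‖z‖ ≤ 1 ∧ z ^ n * (3 - z) = 1 ∧ ‖z - w‖ ≤ 32 / n := by
  have hn0 : (0 : ℝ) < n := by positivity
  have hnC : (n : ℂ) ≠ 0 := by exact_mod_cast hn0.ne'
  set k : ℤ := ⌊n * w.arg / (2 * Real.pi)⌋ with hk
  obtain ⟨z, hz1, hz⟩ := exists_eq_exp_sub_log_div (by omega : 1 < n)
    (c := k * (2 * Real.pi * Complex.I)) (by simp)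
  have h3 := two_le_norm_three_sub hz1
  have h30 : 3 - z ≠ 0 := norm_pos_iff.mp (by linarith)
  refine ⟨z, hz1, ?_, ?_⟩
  · have hpow : z ^ n = (3 - z)⁻¹ := by
      conv_lhs => rw [hz]
      rw [← Complex.exp_nat_mul, mul_div_cancel₀ _ hnC, Complex.exp_sub,
        Complex.exp_int_mul_two_pi_mul_I, Complex.exp_log h30, one_div]
    rw [hpow, inv_mul_cancel₀ h30]
  · have hwexp : w = Complex.exp (w.arg * Complex.I) := by
      simpa [hw] using (Complex.norm_mul_exp_arg_mul_I w).symm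
    set d : ℂ := ((k * (2 * Real.pi) - n * w.arg : ℝ) * Complex.I - Complex.log (3 - z)) / n with hd
    have hlog : ‖Complex.log (3 - z)‖ ≤ 3 + Real.pi := by
      refine (Complex.norm_le_abs_re_add_abs_im _).trans (add_le_add ?_ ?_)
      · rw [Complex.log_re, abs_of_nonneg (Real.log_nonneg (by linarith))]
        have h4 := norm_sub_le (3 : ℂ) z
        norm_num at h4
        have := Real.log_le_sub_one_of_pos (by linarith : 0 < ‖3 - z‖)
        linarith
      · rw [Complex.log_im]; exact Complex.abs_arg_le_pi _
    have hfloor : |k * (2 * Real.pi) - n * w.arg| ≤ 2 * Real.pi := by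
      have hpi := Real.two_pi_pos
      have h1 := Int.floor_le (n * w.arg / (2 * Real.pi))
      have h2 := Int.lt_floor_add_one (n * w.arg / (2 * Real.pi))
      rw [← hk, le_div_iff₀ hpi] at h1
      rw [← hk, div_lt_iff₀ hpi] at h2
      rw [abs_le]
      constructor <;> linarith
    have hdnorm : ‖d‖ ≤ 16 / n := by
      rw [hd, norm_div, Complex.norm_natCast]
      gcongr
      refine (norm_sub_le _ _).trans ?_
      rw [norm_mul, Complex.norm_I, mul_one, Complex.norm_real, Real.norm_eq_abs]
      have := Real.pi_lt_four
      linarith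
    have hd1 : ‖d‖ ≤ 1 := hdnorm.trans <| by
      rw [div_le_one hn0]; exact_mod_cast hn
    have hzd : z = w * Complex.exp d := by
      conv_rhs => rw [hwexp]
      rw [← Complex.exp_add]
      conv_lhs => rw [hz]
      congr 1
      rw [hd]
      push_cast
      field_simp
      ring
    calc ‖z - w‖ = ‖Complex.exp d - 1‖ := by
          rw [hzd, ← mul_sub_one, norm_mul, hw, one_mul]
      _ ≤ 2 * ‖d‖ := Complex.norm_exp_sub_one_le hd1
      _ ≤ 2 * (16 / n) := by gcongr
      _ = 32 / n := by ring

theorem stmt_17 (w : ℂ) (hw : ‖w‖ = 1) (ε : ℝ) (hε : 0 < ε) :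
    ∃ (q : ℝ) (z : ℂ), IsPisot q ∧ IsPisotConj q z ∧ ‖z - w‖ < ε := by
  obtain ⟨m, hm⟩ := exists_nat_gt (32 / ε)
  obtain ⟨z, hz1, hz, hzw⟩ := exists_root_near hw (le_max_right m 16)
  obtain ⟨q, hq, hqz⟩ := exists_isPisot_isPisotConj hz hz1 (by omega)
  refine ⟨q, z, hq, hqz, hzw.trans_lt ?_⟩
  have hmax : (m : ℝ) ≤ (max m 16 : ℕ) := by exact_mod_cast le_max_left m 16
  have hpos : (0 : ℝ) < (max m 16 : ℕ) := by positivity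
  rw [div_lt_iff₀ hε] at hm
  rw [div_lt_iff₀ hpos]
  nlinarith
end

section
/- Every Pisot number q with 1 < q ≤ 1.933 satisfies: every Galois conjugate q' of q has |q'| ≥ (√5 − 1)/2. -/
open Polynomial

/-- The sum of the complex roots of a monic integer polynomial is an integer. -/
lemma exists_int_eq_sum_roots (p : ℤ[X]) (hp : p.Monic) :
    ∃ n : ℤ, (p.map (Int.castRingHom ℂ)).roots.sum = n := by
  have h := (IsAlgClosed.splits (p.map (Int.castRingHom ℂ))).nextCoeff_eq_neg_sum_roots_of_monic
    (hp.map _)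
  refine ⟨-p.nextCoeff, ?_⟩
  rw [nextCoeff_map (RingHom.injective_int (Int.castRingHom ℂ))] at h
  rw [← neg_eq_iff_eq_neg.mpr h]
  simp

/-- If a monic integer polynomial has constant coefficient `±1`, then the sum of `w - w⁻¹` over
its complex roots `w` is an integer. -/
lemma exists_int_eq_sum_roots_sub_inv (p : ℤ[X]) (hp : p.Monic) (h0 : IsUnit (p.coeff 0)) :
    ∃ n : ℤ, ((p.map (Int.castRingHom ℂ)).roots.map fun w => w - w⁻¹).sum = n := by
  obtain ⟨m, hm⟩ := exists_int_eq_sum_roots p hp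
  have hc : ((p.coeff 0 : ℤ) : ℂ) ≠ 0 := by exact_mod_cast h0.ne_zero
  have he : (p.map (Int.castRingHom ℂ)).eval 0 = (p.coeff 0 : ℤ) := by
    rw [← coeff_zero_eq_eval_zero, coeff_map]; simp
  have hd : (derivative (p.map (Int.castRingHom ℂ))).eval 0 = (p.coeff 1 : ℤ) := by
    rw [← coeff_zero_eq_eval_zero, coeff_derivative, coeff_map]; simp
  have h := (IsAlgClosed.splits (p.map (Int.castRingHom ℂ))).eval_derivative_div_eval_of_ne_zero
    (x := 0) (by rwa [he])
  have hinv : ((p.map (Int.castRingHom ℂ)).roots.map fun w => w⁻¹).sum =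
      -((p.coeff 1 : ℤ) / (p.coeff 0 : ℤ) : ℂ) := by
    rw [← he, ← hd, h, ← Multiset.sum_map_neg']
    simp
  rw [Multiset.sum_map_sub, hinv, Multiset.map_id', hm]
  rcases Int.isUnit_iff.mp h0 with h0 | h0
  · exact ⟨m + p.coeff 1, by rw [h0]; simp⟩
  · exact ⟨m - p.coeff 1, by rw [h0]; simp [sub_eq_add_neg, div_neg]⟩

/-- The function `r ↦ r⁻¹ - r` is superadditive from `((0, 1], ·)` to `(ℝ, +)`. -/
lemma inv_sub_self_add_le {r s : ℝ} (hr : 0 < r) (hr1 : r ≤ 1) (hs : 0 < s) (hs1 : s ≤ 1) :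
    (r⁻¹ - r) + (s⁻¹ - s) ≤ (r * s)⁻¹ - r * s := by
  have h : (r * s)⁻¹ - r * s - ((r⁻¹ - r) + (s⁻¹ - s)) =
      (1 - r) * (1 - s) * (1 - r * s) / (r * s) := by
    field_simp; ring
  have : 0 ≤ (1 - r) * (1 - s) * (1 - r * s) / (r * s) := by
    have : r * s ≤ 1 := mul_le_one₀ hr1 hs.le hs1
    apply div_nonneg _ (by positivity)
    exact mul_nonneg (mul_nonneg (by linarith) (by linarith)) (by linarith)
  linarith

lemma abs_re_sub_inv_le {w : ℂ} (hw : w ≠ 0) (hw1 : ‖w‖ ≤ 1) :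
    |(w - w⁻¹).re| ≤ ‖w‖⁻¹ - ‖w‖ := by
  have hpos : 0 < ‖w‖ := norm_pos_iff.mpr hw
  have hn : Complex.normSq w = ‖w‖ ^ 2 := Complex.normSq_eq_norm_sq w
  have h : (w - w⁻¹).re = -(w.re * ((1 - ‖w‖ ^ 2) / ‖w‖ ^ 2)) := by
    rw [Complex.sub_re, Complex.inv_re, hn]
    field_simp; ring
  have hsq : 0 ≤ (1 - ‖w‖ ^ 2) / ‖w‖ ^ 2 := by
    apply div_nonneg _ (by positivity)
    nlinarith
  rw [h, abs_neg, abs_mul, abs_of_nonneg hsq]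
  calc |w.re| * ((1 - ‖w‖ ^ 2) / ‖w‖ ^ 2) ≤ ‖w‖ * ((1 - ‖w‖ ^ 2) / ‖w‖ ^ 2) :=
        mul_le_mul_of_nonneg_right (Complex.abs_re_le_norm w) hsq
    _ = ‖w‖⁻¹ - ‖w‖ := by field_simp

lemma prod_norm_mem_Ioc (M : Multiset ℂ) (hM : ∀ w ∈ M, w ≠ 0 ∧ ‖w‖ ≤ 1) :
    (M.map norm).prod ∈ Set.Ioc (0 : ℝ) 1 := by
  induction M using Multiset.induction_on with
  | empty => simp
  | cons w M ih =>
    obtain ⟨h0, h1⟩ := ih fun v hv => hM v (Multiset.mem_cons_of_mem hv)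
    obtain ⟨hw, hw1⟩ := hM w (Multiset.mem_cons_self w M)
    rw [Multiset.map_cons, Multiset.prod_cons]
    exact ⟨mul_pos (norm_pos_iff.mpr hw) h0, mul_le_one₀ hw1 h0.le h1⟩

lemma abs_re_sum_sub_inv_le (M : Multiset ℂ) (hM : ∀ w ∈ M, w ≠ 0 ∧ ‖w‖ ≤ 1) :
    |(M.map fun w => w - w⁻¹).sum.re| ≤ (M.map norm).prod⁻¹ - (M.map norm).prod := by
  induction M using Multiset.induction_on with
  | empty => simp
  | cons w M ih =>
    have hM' : ∀ v ∈ M, v ≠ 0 ∧ ‖v‖ ≤ 1 := fun v hv => hM v (Multiset.mem_cons_of_mem hv)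
    obtain ⟨h0, h1⟩ := prod_norm_mem_Ioc M hM'
    obtain ⟨hw, hw1⟩ := hM w (Multiset.mem_cons_self w M)
    rw [Multiset.map_cons, Multiset.map_cons, Multiset.prod_cons, Multiset.sum_cons,
      Complex.add_re]
    exact (abs_add_le _ _).trans ((add_le_add (abs_re_sub_inv_le hw hw1) (ih hM')).trans
      (inv_sub_self_add_le (norm_pos_iff.mpr hw) hw1 h0 h1))

/-- A negative conjugate `-b⁻¹` with `b` above the golden ratio is impossible: the integer
`q - q⁻¹ + (b - b⁻¹) + δ` would lie strictly between `2` and `3`. -/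
lemma false_of_neg_conj {q b δ : ℝ} (n : ℤ) (hq2 : q < 2) (hb1 : 1 < b) (hb : b + 1 < b ^ 2)
    (hbq : b ≤ q) (hδ : |δ| ≤ q / b - b / q) (hn : q - q⁻¹ + (b - b⁻¹) + δ = n) : False := by
  have hb0 : 0 < b := by linarith
  have hq0 : 0 < q := by linarith
  obtain ⟨hδ1, hδ2⟩ := abs_le.mp hδ
  have hsb : 1 < b - b⁻¹ := by
    have : b - b⁻¹ - 1 = (b ^ 2 - (b + 1)) / b := by field_simp; ring
    have : 0 < (b ^ 2 - (b + 1)) / b := div_pos (by linarith) hb0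
    linarith
  have hsq : q - q⁻¹ < 3 / 2 := by
    have : 2⁻¹ < q⁻¹ := by gcongr
    norm_num at this
    linarith
  have hlow : q - q⁻¹ - (q / b - b / q) - (b - b⁻¹) =
      (b - 1) * (q - b) * (q - 1) / (b * q) := by
    field_simp; ring
  have hlow0 : 0 ≤ (b - 1) * (q - b) * (q - 1) / (b * q) := by
    apply div_nonneg _ (by positivity)
    exact mul_nonneg (mul_nonneg (by linarith) (by linarith)) (by linarith)
  have hlt : (2 : ℤ) < n := by
    have : (2 : ℝ) < n := by linarith
    exact_mod_cast this
  have hgt : n < (3 : ℤ) := by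
    have : (n : ℝ) < 3 := by linarith
    exact_mod_cast this
  omega

/-- For a positive conjugate `b⁻¹` with `b` above the golden ratio, the integer
`q - q⁻¹ - (b - b⁻¹) + δ` lies in `[0, 1)` and vanishes only if `b = q`. -/
lemma eq_of_pos_conj {q b δ : ℝ} (n : ℤ) (hq2 : q < 2) (hb1 : 1 < b) (hb : b + 1 < b ^ 2)
    (hbq : b ≤ q) (hδ : |δ| ≤ q / b - b / q) (hn : q - q⁻¹ - (b - b⁻¹) + δ = n) : b = q := by
  have hb0 : 0 < b := by linarith
  have hq0 : 0 < q := by linarith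
  obtain ⟨hδ1, hδ2⟩ := abs_le.mp hδ
  by_contra hne
  have hlt' : b < q := lt_of_le_of_ne hbq hne
  have hlow : q - q⁻¹ - (q / b - b / q) - (b - b⁻¹) =
      (b - 1) * (q - b) * (q - 1) / (b * q) := by
    field_simp; ring
  have hlow0 : 0 < (b - 1) * (q - b) * (q - 1) / (b * q) := by
    apply div_pos _ (by positivity)
    exact mul_pos (mul_pos (by linarith) (by linarith)) (by linarith)
  have hb16 : 1.6 < b := by nlinarith
  have hsb : 1 < b - b⁻¹ := by
    have : b - b⁻¹ - 1 = (b ^ 2 - (b + 1)) / b := by field_simp; ring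
    have : 0 < (b ^ 2 - (b + 1)) / b := div_pos (by linarith) hb0
    linarith
  have hsq : q - q⁻¹ < 3 / 2 := by
    have : 2⁻¹ < q⁻¹ := by gcongr
    norm_num at this
    linarith
  have hquot : q / b - b / q < 1 / 2 := by
    have h1 : q / b < 1.25 := by rw [div_lt_iff₀ hb0]; linarith
    have h2 : 0.8 < b / q := by rw [lt_div_iff₀ hq0]; linarith
    linarith
  have hgt : (0 : ℤ) < n := by
    have : (0 : ℝ) < n := by linarith
    exact_mod_cast this
  have hlt : n < (1 : ℤ) := by
    have : (n : ℝ) < 1 := by linarith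
    exact_mod_cast this
  omega

lemma multiset_eq_zero_of_prod_norm_eq_one {M : Multiset ℂ} (hM : ∀ w ∈ M, w ≠ 0 ∧ ‖w‖ < 1)
    (h : (M.map norm).prod = 1) : M = 0 := by
  by_contra hne
  obtain ⟨w, hw⟩ := Multiset.exists_mem_of_ne_zero hne
  obtain ⟨M', rfl⟩ := Multiset.exists_cons_of_mem hw
  obtain ⟨h0, h1⟩ := prod_norm_mem_Ioc M' fun v hv =>
    ⟨(hM v (Multiset.mem_cons_of_mem hv)).1, (hM v (Multiset.mem_cons_of_mem hv)).2.le⟩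
  rw [Multiset.map_cons, Multiset.prod_cons] at h
  have := (hM w hw).2
  nlinarith [norm_nonneg w]

/-- If the roots of a monic integer polynomial with constant coefficient `±1` are `q ∈ (1, 2)`, a
real number `a` and a multiset `M`, where `a` and the elements of `M` lie in the open unit disc,
then `|a|` is at least the inverse of the golden ratio. -/
lemma le_abs_of_roots_eq {p : ℤ[X]} (hp : p.Monic) (h0 : IsUnit (p.coeff 0)) {q a : ℝ}
    {M : Multiset ℂ} (hR : (p.map (Int.castRingHom ℂ)).roots = (q : ℂ) ::ₘ (a : ℂ) ::ₘ M)
    (hq1 : 1 < q) (hq2 : q < 2) (ha1 : |a| < 1) (hM : ∀ w ∈ M, w ≠ 0 ∧ ‖w‖ < 1)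
    (hprod : q * |a| * (M.map norm).prod = 1) : (√5 - 1) / 2 ≤ |a| := by
  by_contra! hlt
  have hM' : ∀ w ∈ M, w ≠ 0 ∧ ‖w‖ ≤ 1 := fun w hw => ⟨(hM w hw).1, (hM w hw).2.le⟩
  obtain ⟨hr0, hr1⟩ := prod_norm_mem_Ioc M hM'
  have hδ := abs_re_sum_sub_inv_le M hM'
  obtain ⟨n, hn⟩ := exists_int_eq_sum_roots_sub_inv p hp h0
  obtain ⟨m, hm⟩ := exists_int_eq_sum_roots p hp
  have hn' := congrArg Complex.re hn
  have hm' := congrArg Complex.re hm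
  rw [hR] at hn' hm'
  set r := (M.map norm).prod with hr
  set δ := (M.map fun w => w - w⁻¹).sum.re with hδdef
  simp only [Multiset.map_cons, Multiset.sum_cons, Complex.add_re, Complex.sub_re,
    ← Complex.ofReal_inv, Complex.ofReal_re, ← hδdef, Complex.intCast_re] at hn' hm'
  have hq0 : 0 < q := by linarith
  have ha0 : 0 < |a| := by
    rcases (abs_nonneg a).eq_or_lt with h | h
    · rw [← h] at hprod; simp at hprod
    · exact h
  have h5 : √5 ^ 2 = 5 := Real.sq_sqrt (by norm_num)
  have h50 : 0 ≤ √5 := Real.sqrt_nonneg 5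
  have hgold : |a| ^ 2 + |a| < 1 := by nlinarith
  obtain ⟨b, hbdef⟩ : ∃ b, b = |a|⁻¹ := ⟨_, rfl⟩
  have hab : |a| = b⁻¹ := by rw [hbdef, inv_inv]
  have hb1 : 1 < b := by rw [hbdef]; exact (one_lt_inv₀ ha0).mpr ha1
  have hb0 : 0 < b := by linarith
  have hb : b + 1 < b ^ 2 := by
    rw [hab] at hgold
    have : b⁻¹ ^ 2 + b⁻¹ = (b + 1) / b ^ 2 := by field_simp; ring
    rw [this, div_lt_one (by positivity)] at hgold
    exact hgold
  have hrb : r = b / q := by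
    rw [hab] at hprod
    field_simp at hprod ⊢
    linarith
  have hbq : b ≤ q := by
    rwa [hrb, div_le_one hq0] at hr1
  rw [hrb, inv_div] at hδ
  rcases le_or_gt 0 a with ha | ha
  · rw [abs_of_nonneg ha] at hab
    have hbq' : b = q := by
      refine eq_of_pos_conj n hq2 hb1 hb hbq hδ ?_
      rw [← hn', hab, inv_inv]; ring
    have hM0 : M = 0 := by
      refine multiset_eq_zero_of_prod_norm_eq_one hM ?_
      rw [← hr, hrb, hbq', div_self hq0.ne']
    rw [hM0, hab, hbq'] at hm'
    simp only [Multiset.sum_zero, Complex.zero_re, add_zero] at hm'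
    have hsum : q + q⁻¹ = 2 + (q - 1) ^ 2 / q := by field_simp; ring
    have hpos : 0 < (q - 1) ^ 2 / q := by
      have : q - 1 ≠ 0 := by linarith
      positivity
    have hinv : q⁻¹ < 1 := inv_lt_one_of_one_lt₀ hq1
    have hgt : (2 : ℤ) < m := by
      have : (2 : ℝ) < m := by linarith
      exact_mod_cast this
    have hlt : m < (3 : ℤ) := by
      have : (m : ℝ) < 3 := by linarith
      exact_mod_cast this
    omega
  · rw [abs_of_neg ha] at hab
    have hab' : a = -b⁻¹ := by linarith
    refine false_of_neg_conj n hq2 hb1 hb hbq hδ ?_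
    rw [← hn', hab', inv_neg, inv_inv]; ring

theorem stmt_18 (q : ℝ) (hq : IsPisot q) (h1 : 1 < q) (h2 : q ≤ 1.933)
    (z : ℂ) (hz : IsPisotConj q z) :
    (Real.sqrt 5 - 1) / 2 ≤ ‖z‖ := by
  obtain ⟨-, hint, hconj⟩ := hq
  obtain ⟨hz0, hzq⟩ := hz
  have hq2 : q < 2 := by linarith
  have hz1 := hconj z hz0 hzq
  have hminpoly : minpoly ℚ q = (minpoly ℤ q).map (algebraMap ℤ ℚ) :=
    minpoly.isIntegrallyClosed_eq_field_fractions' ℚ hint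
  have hmonic := minpoly.monic hint
  set p := minpoly ℤ q
  have hintQ : IsIntegral ℚ q := hint.tower_top
  have hmap : p.map (Int.castRingHom ℂ) = (minpoly ℚ q).map (algebraMap ℚ ℂ) := by
    rw [hminpoly, Polynomial.map_map]
    congr 1
  have hmem : ∀ w : ℂ, w ∈ (p.map (Int.castRingHom ℂ)).roots ↔ aeval w (minpoly ℚ q) = 0 := by
    intro w
    rw [hmap, ← aroots_def, mem_aroots]
    exact and_iff_right (minpoly.ne_zero hintQ)
  have hnodup : (p.map (Int.castRingHom ℂ)).roots.Nodup := by
    rw [hmap]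
    exact nodup_roots ((minpoly.irreducible hintQ).separable.map)
  have hcoeff : p.coeff 0 ≠ 0 := by
    have h := minpoly.coeff_zero_ne_zero hintQ (zero_lt_one.trans h1).ne'
    rw [hminpoly, coeff_map] at h
    exact fun h0 => h (by rw [h0, map_zero])
  have hne0 : ∀ w ∈ (p.map (Int.castRingHom ℂ)).roots, w ≠ 0 := by
    rintro w hw rfl
    have := isRoot_of_mem_roots hw
    rw [IsRoot, ← coeff_zero_eq_eval_zero, coeff_map] at this
    simp [hcoeff] at this
  have hqroot : (q : ℂ) ∈ (p.map (Int.castRingHom ℂ)).roots := by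
    rw [hmem]
    have := aeval_algebraMap_apply ℂ q (minpoly ℚ q)
    simpa using this
  obtain ⟨R, hR⟩ := Multiset.exists_cons_of_mem hqroot
  have hqR : (q : ℂ) ∉ R := by
    rw [hR] at hnodup
    exact (Multiset.nodup_cons.mp hnodup).1
  have hRdisc : ∀ w ∈ R, w ≠ 0 ∧ ‖w‖ < 1 := by
    intro w hw
    have hw' : w ∈ (p.map (Int.castRingHom ℂ)).roots := by
      rw [hR]; exact Multiset.mem_cons_of_mem hw
    exact ⟨hne0 w hw', hconj w ((hmem w).mp hw') fun h => hqR (h ▸ hw)⟩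
  have hmemR : ∀ w : ℂ, aeval w (minpoly ℚ q) = 0 → w ≠ q → w ∈ R := by
    intro w hw hwq
    rw [← hmem, hR] at hw
    exact (Multiset.mem_cons.mp hw).resolve_left hwq
  obtain ⟨hr0, hr1⟩ := prod_norm_mem_Ioc R fun w hw => ⟨(hRdisc w hw).1, (hRdisc w hw).2.le⟩
  have hnorm : |(p.coeff 0 : ℝ)| = q * (R.map norm).prod := by
    have h := (IsAlgClosed.splits (p.map (Int.castRingHom ℂ))).coeff_zero_eq_prod_roots_of_monic
      (hmonic.map _)
    have h' := congrArg norm h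
    rw [hR, norm_mul, norm_pow, norm_neg, norm_one, one_pow, one_mul, Multiset.prod_cons,
      norm_mul, coeff_map, Complex.norm_real, Real.norm_of_nonneg (by linarith)] at h'
    rw [show (R.map norm).prod = ‖R.prod‖ from Multiset.prod_hom R (normHom : ℂ →*₀ ℝ)]
    simpa using h'
  have hunit : |p.coeff 0| = 1 := by
    have hlt : |p.coeff 0| < 2 := by
      have : |(p.coeff 0 : ℝ)| < 2 := by rw [hnorm]; nlinarith
      exact_mod_cast this
    have := abs_pos.mpr hcoeff
    omega
  have hprod : q * (R.map norm).prod = 1 := by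
    rw [← hnorm]; exact_mod_cast hunit
  obtain ⟨M, hM⟩ := Multiset.exists_cons_of_mem (hmemR z hz0 hzq)
  have hMdisc : ∀ w ∈ M, w ≠ 0 ∧ ‖w‖ < 1 := fun w hw =>
    hRdisc w (hM ▸ Multiset.mem_cons_of_mem hw)
  rw [hM, Multiset.map_cons, Multiset.prod_cons, ← mul_assoc] at hprod
  by_cases hreal : starRingEnd ℂ z = z
  · obtain ⟨a, rfl⟩ := Complex.conj_eq_iff_real.mp hreal
    rw [Complex.norm_real, Real.norm_eq_abs] at hprod hz1 ⊢
    exact le_abs_of_roots_eq hmonic (Int.isUnit_iff_abs_eq.mpr hunit) (hM ▸ hR) h1 hq2 hz1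
      hMdisc hprod
  · have hzc : starRingEnd ℂ z ∈ R := by
      refine hmemR _ ?_ ?_
      · have := aeval_algHom_apply (Complex.conjAe.toAlgHom.restrictScalars ℚ) z (minpoly ℚ q)
        simpa [hz0] using this
      · intro h
        apply hzq
        have := congrArg (starRingEnd ℂ) h
        simpa using this
    rw [hM] at hzc
    obtain ⟨M', rfl⟩ := Multiset.exists_cons_of_mem ((Multiset.mem_cons.mp hzc).resolve_left hreal)
    obtain ⟨hs0, hs1⟩ := prod_norm_mem_Ioc M' fun w hw =>
      ⟨(hMdisc w (Multiset.mem_cons_of_mem hw)).1, (hMdisc w (Multiset.mem_cons_of_mem hw)).2.le⟩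
    rw [Multiset.map_cons, Multiset.prod_cons, Complex.norm_conj] at hprod
    have hzsq : 1 ≤ 2 * ‖z‖ ^ 2 := by
      calc 1 = q * ‖z‖ ^ 2 * (M'.map norm).prod := by rw [← hprod]; ring
        _ ≤ q * ‖z‖ ^ 2 * 1 := by gcongr
        _ ≤ 2 * ‖z‖ ^ 2 := by rw [mul_one]; gcongr
    have h5 : √5 < 2.25 := by
      rw [Real.sqrt_lt' (by norm_num)]; norm_num
    nlinarith [norm_nonneg z]
end
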